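/- arXiv:2106.04044 — 8 statements merged into one kernel-verified Lean document; each statement's English description precedes it below -/
import Mathlib

section
/- Suppose the function A(x) := √(a² − f(x)²)/f'(x) is monotonically decreasing on (0, π/2). Then the half period function φ_f is monotonically decreasing on (0, a). Moreover, if A is strictly decreasing on (0, π/2), then φ_f is strictly decreasing on (0, a). -/
open Real Set

/-- The angle `θ` associated to a height `y ∈ (ν, a)` by
`1 / y ^ 2 = cos θ ^ 2 / ν ^ 2 + sin θ ^ 2 / a ^ 2`. -/
noncomputable def heightAngle (ν a y : ℝ) : ℝ :=
  arctan (a * √(y ^ 2 - ν ^ 2) / (ν * √(a ^ 2 - y ^ 2)))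

/-- The height `y` with `1 / y ^ 2 = cos θ ^ 2 / ν ^ 2 + sin θ ^ 2 / a ^ 2`. -/
noncomputable def angleHeight (ν a θ : ℝ) : ℝ :=
  ν * a / √(a ^ 2 * cos θ ^ 2 + ν ^ 2 * sin θ ^ 2)

lemma heightAngle_mem_Ioo {ν a y : ℝ} (hν : 0 < ν) (hy : y ∈ Ioo ν a) :
    heightAngle ν a y ∈ Ioo 0 (π / 2) := by
  have h0 : 0 < y := hν.trans hy.1
  have ha : 0 < a := h0.trans hy.2
  have h1 : 0 < y ^ 2 - ν ^ 2 := by nlinarith [hy.1]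
  have h2 : 0 < a ^ 2 - y ^ 2 := by nlinarith [hy.2]
  exact ⟨arctan_pos.2 (by positivity), arctan_lt_pi_div_two _⟩

lemma strictMonoOn_heightAngle {ν a : ℝ} (hν : 0 < ν) :
    StrictMonoOn (heightAngle ν a) (Ioo ν a) := by
  intro y hy z hz hyz
  have hy0 : 0 < y := hν.trans hy.1
  have ha : 0 < a := hy0.trans hy.2
  have h2 : 0 < a ^ 2 - z ^ 2 := by nlinarith [hz.1, hz.2]
  refine arctan_strictMono ?_
  have h3 : √(y ^ 2 - ν ^ 2) < √(z ^ 2 - ν ^ 2) :=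
    sqrt_lt_sqrt (by nlinarith [hy.1]) (by nlinarith)
  have h4 : √(a ^ 2 - z ^ 2) ≤ √(a ^ 2 - y ^ 2) := sqrt_le_sqrt (by nlinarith)
  have h5 : 0 < √(a ^ 2 - z ^ 2) := sqrt_pos.2 h2
  exact div_lt_div₀ (by gcongr) (by gcongr) (by positivity) (by positivity)

lemma hasDerivAt_heightAngle {ν a y : ℝ} (hν : 0 < ν) (hy : y ∈ Ioo ν a) :
    HasDerivAt (heightAngle ν a)
      (a * ν / (y * √(y ^ 2 - ν ^ 2) * √(a ^ 2 - y ^ 2))) y := by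
  have h0 : 0 < y := hν.trans hy.1
  have ha : 0 < a := h0.trans hy.2
  have h1 : 0 < y ^ 2 - ν ^ 2 := by nlinarith [hy.1]
  have h2 : 0 < a ^ 2 - y ^ 2 := by nlinarith [hy.2]
  have d1 : HasDerivAt (fun y : ℝ => √(y ^ 2 - ν ^ 2)) (2 * y / (2 * √(y ^ 2 - ν ^ 2))) y := by
    simpa using ((hasDerivAt_pow 2 y).sub_const (ν ^ 2)).sqrt h1.ne'
  have d2 : HasDerivAt (fun y : ℝ => √(a ^ 2 - y ^ 2)) (-(2 * y) / (2 * √(a ^ 2 - y ^ 2))) y := by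
    simpa using ((hasDerivAt_pow 2 y).const_sub (a ^ 2)).sqrt h2.ne'
  have e1 := sq_sqrt h1.le
  have e2 := sq_sqrt h2.le
  have p1 := sqrt_pos.2 h1
  have p2 := sqrt_pos.2 h2
  have d := ((d1.const_mul a).fun_div (d2.const_mul ν) (by positivity)).arctan
  refine d.congr_deriv ?_
  clear d d1 d2
  generalize √(y ^ 2 - ν ^ 2) = P at *
  generalize √(a ^ 2 - y ^ 2) = Q at *
  have e3 : ν ^ 2 * Q ^ 2 + a ^ 2 * P ^ 2 = y ^ 2 * (P ^ 2 + Q ^ 2) := by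
    rw [e1, e2]; ring
  have e4 : 1 + (a * P / (ν * Q)) ^ 2 = y ^ 2 * (P ^ 2 + Q ^ 2) / (ν * Q) ^ 2 := by
    rw [← e3]; field_simp
  rw [e4]
  field_simp
  ring

lemma angleHeight_radicand_pos {ν a θ : ℝ} (hν : 0 < ν) (ha : 0 < a) :
    0 < a ^ 2 * cos θ ^ 2 + ν ^ 2 * sin θ ^ 2 := by
  by_cases h : cos θ = 0
  · have := sin_sq_add_cos_sq θ
    rw [h] at this ⊢
    have h1 : sin θ ^ 2 = 1 := by linarith
    rw [h1]; positivity
  · positivity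

lemma angleHeight_pos {ν a θ : ℝ} (hν : 0 < ν) (ha : 0 < a) : 0 < angleHeight ν a θ :=
  div_pos (mul_pos hν ha) (sqrt_pos.2 (angleHeight_radicand_pos hν ha))

lemma angleHeight_sq_sub {ν a θ : ℝ} (hν : 0 < ν) (ha : 0 < a) :
    angleHeight ν a θ ^ 2 - ν ^ 2 =
      (a ^ 2 - ν ^ 2) / (a ^ 2 * cos θ ^ 2 + ν ^ 2 * sin θ ^ 2) * (ν * sin θ) ^ 2 := by
  have h := angleHeight_radicand_pos (θ := θ) hν ha
  rw [angleHeight, div_pow, sq_sqrt h.le]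
  field_simp
  linear_combination (-a ^ 2) * sin_sq_add_cos_sq θ

lemma sub_angleHeight_sq {ν a θ : ℝ} (hν : 0 < ν) (ha : 0 < a) :
    a ^ 2 - angleHeight ν a θ ^ 2 =
      (a ^ 2 - ν ^ 2) / (a ^ 2 * cos θ ^ 2 + ν ^ 2 * sin θ ^ 2) * (a * cos θ) ^ 2 := by
  have h := angleHeight_radicand_pos (θ := θ) hν ha
  rw [angleHeight, div_pow, sq_sqrt h.le]
  field_simp
  linear_combination ν ^ 2 * sin_sq_add_cos_sq θ

lemma sin_pos_and_cos_pos {θ : ℝ} (hθ : θ ∈ Ioo 0 (π / 2)) : 0 < sin θ ∧ 0 < cos θ :=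
  ⟨sin_pos_of_pos_of_lt_pi hθ.1 (by linarith [hθ.2, pi_pos]),
    cos_pos_of_mem_Ioo ⟨by linarith [hθ.1, pi_pos], hθ.2⟩⟩

lemma angleHeight_mem_Ioo {ν a θ : ℝ} (hν : ν ∈ Ioo 0 a) (hθ : θ ∈ Ioo 0 (π / 2)) :
    angleHeight ν a θ ∈ Ioo ν a := by
  obtain ⟨hν0, hνa⟩ := hν
  have ha : 0 < a := hν0.trans hνa
  obtain ⟨hs, hc⟩ := sin_pos_and_cos_pos hθ
  have h := angleHeight_radicand_pos (θ := θ) hν0 ha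
  have h1 : 0 < a ^ 2 - ν ^ 2 := by nlinarith
  constructor
  · refine lt_of_pow_lt_pow_left₀ 2 (angleHeight_pos hν0 ha).le (sub_pos.1 ?_)
    rw [angleHeight_sq_sub hν0 ha]
    positivity
  · refine lt_of_pow_lt_pow_left₀ 2 ha.le (sub_pos.1 ?_)
    rw [sub_angleHeight_sq hν0 ha]
    positivity

lemma heightAngle_angleHeight {ν a θ : ℝ} (hν : ν ∈ Ioo 0 a) (hθ : θ ∈ Ioo 0 (π / 2)) :
    heightAngle ν a (angleHeight ν a θ) = θ := by
  obtain ⟨hν0, hνa⟩ := hν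
  have ha : 0 < a := hν0.trans hνa
  obtain ⟨hs, hc⟩ := sin_pos_and_cos_pos hθ
  have h := angleHeight_radicand_pos (θ := θ) hν0 ha
  have h1 : 0 < (a ^ 2 - ν ^ 2) / (a ^ 2 * cos θ ^ 2 + ν ^ 2 * sin θ ^ 2) :=
    div_pos (by nlinarith) h
  have h2 := sqrt_pos.2 h1
  rw [heightAngle, angleHeight_sq_sub hν0 ha, sub_angleHeight_sq hν0 ha, sqrt_mul h1.le,
    sqrt_mul h1.le, sqrt_sq (by positivity), sqrt_sq (by positivity)]
  have e : ∀ S : ℝ, 0 < S → a * (S * (ν * sin θ)) / (ν * (S * (a * cos θ))) = tan θ := by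
    intro S hS
    rw [tan_eq_sin_div_cos]
    field_simp
  rw [e _ h2, arctan_tan (by linarith [hθ.1, pi_pos]) hθ.2]

lemma angleHeight_lt_angleHeight {ν μ a θ : ℝ} (hν : 0 < ν) (hνμ : ν < μ) (ha : 0 < a)
    (hθ : θ ∈ Ioo 0 (π / 2)) : angleHeight ν a θ < angleHeight μ a θ := by
  have hc := (sin_pos_and_cos_pos hθ).2
  have hμ : 0 < μ := hν.trans hνμ
  have h1 := angleHeight_radicand_pos (θ := θ) hν ha
  have h2 := angleHeight_radicand_pos (θ := θ) hμ ha
  refine lt_of_pow_lt_pow_left₀ 2 (angleHeight_pos hμ ha).le ?_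
  rw [angleHeight, angleHeight, div_pow, div_pow, sq_sqrt h1.le, sq_sqrt h2.le,
    div_lt_div_iff₀ h1 h2]
  have h3 : 0 < a ^ 4 * cos θ ^ 2 * (μ ^ 2 - ν ^ 2) := by
    have : 0 < μ ^ 2 - ν ^ 2 := by nlinarith
    positivity
  nlinarith

lemma monotoneOn_angleHeight {ν a : ℝ} (hν : ν ∈ Ioo 0 a) :
    MonotoneOn (angleHeight ν a) (Ioo 0 (π / 2)) := by
  intro s hs t ht hst
  by_contra! hlt
  have := strictMonoOn_heightAngle hν.1 (angleHeight_mem_Ioo hν ht) (angleHeight_mem_Ioo hν hs) hlt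
  rw [heightAngle_angleHeight hν hs, heightAngle_angleHeight hν ht] at this
  exact this.not_ge hst

section HalfPeriod

variable {f finv A : ℝ → ℝ} {a ν : ℝ}

lemma inverse_mem_Ioo (ha : a = f (π / 2))
    (hfinv : ∀ ν ∈ Ioo 0 a, finv ν ∈ Icc 0 (π / 2) ∧ f (finv ν) = ν) (hf0 : f 0 = 0)
    (hν : ν ∈ Ioo 0 a) : finv ν ∈ Ioo 0 (π / 2) := by
  obtain ⟨h1, h2⟩ := hfinv ν hν
  refine ⟨h1.1.lt_of_ne ?_, h1.2.lt_of_ne ?_⟩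
  · intro h
    rw [← h, hf0] at h2
    exact hν.1.ne h2
  · intro h
    rw [h, ← ha] at h2
    exact hν.2.ne' h2

lemma strictMonoOn_inverse (hmono : StrictMonoOn f (Icc 0 (π / 2)))
    (hfinv : ∀ ν ∈ Ioo 0 a, finv ν ∈ Icc 0 (π / 2) ∧ f (finv ν) = ν) :
    StrictMonoOn finv (Ioo 0 a) := by
  intro y hy z hz hyz
  rwa [← hmono.lt_iff_lt (hfinv y hy).1 (hfinv z hz).1, (hfinv y hy).2, (hfinv z hz).2]

lemma integral_half_period_eq (hf : Differentiable ℝ f) (hf0 : f 0 = 0)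
    (hmono : StrictMonoOn f (Icc 0 (π / 2)))
    (hf' : ∀ x ∈ Ioo 0 (π / 2), 0 < deriv f x) (ha : a = f (π / 2))
    (hfinv : ∀ ν ∈ Ioo 0 a, finv ν ∈ Icc 0 (π / 2) ∧ f (finv ν) = ν)
    (hA : ∀ x, A x = √(a ^ 2 - f x ^ 2) / deriv f x) (hν : ν ∈ Ioo 0 a) :
    ∫ θ in 0..π / 2, A (finv (angleHeight ν a θ)) =
      a * ∫ x in finv ν..π / 2, ν / (f x * √(f x ^ 2 - ν ^ 2)) := by
  have hx0 := inverse_mem_Ioo ha hfinv hf0 hν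
  have hsub : Ioo (finv ν) (π / 2) ⊆ Ioo 0 (π / 2) := Ioo_subset_Ioo_left hx0.1.le
  have hmaps : MapsTo f (Ioo (finv ν) (π / 2)) (Ioo ν a) := by
    intro x hx
    have hxI := Ioo_subset_Icc_self (hsub hx)
    constructor
    · simpa only [(hfinv ν hν).2] using hmono (hfinv ν hν).1 hxI hx.1
    · rw [ha]
      exact hmono hxI (right_mem_Icc.2 (by positivity)) hx.2
  have hinvmaps : ∀ y ∈ Ioo ν a, finv y ∈ Ioo (finv ν) (π / 2) := fun y hy =>
    have hy' : y ∈ Ioo 0 a := ⟨hν.1.trans hy.1, hy.2⟩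
    ⟨strictMonoOn_inverse hmono hfinv hν hy' hy.1, (inverse_mem_Ioo ha hfinv hf0 hy').2⟩
  have hinj : InjOn (fun x => heightAngle ν a (f x)) (Ioo (finv ν) (π / 2)) :=
    (strictMonoOn_heightAngle hν.1).injOn.comp
      (hmono.injOn.mono (hsub.trans Ioo_subset_Icc_self)) hmaps
  have hright : ∀ θ ∈ Ioo 0 (π / 2),
      heightAngle ν a (f (finv (angleHeight ν a θ))) = θ := by
    intro θ hθ
    have hy := angleHeight_mem_Ioo hν hθ
    rw [(hfinv _ ⟨hν.1.trans hy.1, hy.2⟩).2, heightAngle_angleHeight hν hθ]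
  have himage : (fun x => heightAngle ν a (f x)) '' Ioo (finv ν) (π / 2) = Ioo 0 (π / 2) := by
    ext θ
    constructor
    · rintro ⟨x, hx, rfl⟩
      exact heightAngle_mem_Ioo hν.1 (hmaps hx)
    · intro hθ
      exact ⟨_, hinvmaps _ (angleHeight_mem_Ioo hν hθ), hright θ hθ⟩
  have hderiv : ∀ x ∈ Ioo (finv ν) (π / 2),
      HasDerivWithinAt (fun x => heightAngle ν a (f x))
        (a * ν / (f x * √(f x ^ 2 - ν ^ 2) * √(a ^ 2 - f x ^ 2)) * deriv f x)
        (Ioo (finv ν) (π / 2)) x := fun x hx =>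
    ((hasDerivAt_heightAngle hν.1 (hmaps hx)).comp x (hf x).hasDerivAt).hasDerivWithinAt
  rw [intervalIntegral.integral_of_le (by positivity), intervalIntegral.integral_of_le hx0.2.le,
    MeasureTheory.integral_Ioc_eq_integral_Ioo, MeasureTheory.integral_Ioc_eq_integral_Ioo,
    ← himage, MeasureTheory.integral_image_eq_integral_abs_deriv_smul measurableSet_Ioo hderiv hinj,
    ← MeasureTheory.integral_const_mul]
  refine MeasureTheory.setIntegral_congr_fun measurableSet_Ioo fun x hx => ?_
  have hθ := heightAngle_mem_Ioo hν.1 (hmaps hx)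
  have hback : finv (angleHeight ν a (heightAngle ν a (f x))) = x :=
    hinj (hinvmaps _ (angleHeight_mem_Ioo hν hθ)) hx (hright _ hθ)
  obtain ⟨h1, h2⟩ := hmaps hx
  have hν0 := hν.1
  have h0 : 0 < f x := hν0.trans h1
  have ha0 : 0 < a := h0.trans h2
  have hd := hf' x (hsub hx)
  have p1 : 0 < √(f x ^ 2 - ν ^ 2) := sqrt_pos.2 (by nlinarith)
  have p2 : 0 < √(a ^ 2 - f x ^ 2) := sqrt_pos.2 (by nlinarith)
  simp only [hback, hA, smul_eq_mul]
  rw [abs_of_pos (by positivity)]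
  field_simp

lemma intervalIntegrable_comp_angleHeight (hf0 : f 0 = 0)
    (hmono : StrictMonoOn f (Icc 0 (π / 2))) (ha : a = f (π / 2))
    (hfinv : ∀ ν ∈ Ioo 0 a, finv ν ∈ Icc 0 (π / 2) ∧ f (finv ν) = ν)
    (hA0 : ∀ x ∈ Ioo 0 (π / 2), 0 ≤ A x) (hA : AntitoneOn A (Ioo 0 (π / 2)))
    (hν : ν ∈ Ioo 0 a) :
    IntervalIntegrable (fun θ => A (finv (angleHeight ν a θ))) MeasureTheory.volume 0 (π / 2) := by
  have hy : ∀ θ ∈ Ioo 0 (π / 2), angleHeight ν a θ ∈ Ioo 0 a := fun θ hθ =>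
    Ioo_subset_Ioo_left hν.1.le (angleHeight_mem_Ioo hν hθ)
  have hx : ∀ θ ∈ Ioo 0 (π / 2), finv (angleHeight ν a θ) ∈ Ioo 0 (π / 2) := fun θ hθ =>
    inverse_mem_Ioo ha hfinv hf0 (hy θ hθ)
  have hanti : AntitoneOn (fun θ => A (finv (angleHeight ν a θ))) (Ioo 0 (π / 2)) :=
    fun s hs t ht hst => hA (hx s hs) (hx t ht)
      ((strictMonoOn_inverse hmono hfinv).monotoneOn (hy s hs) (hy t ht)
        (monotoneOn_angleHeight hν hs ht hst))
  rw [intervalIntegrable_iff_integrableOn_Ioo_of_le (by positivity)]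
  refine .of_bound (by simp)
    (aemeasurable_restrict_of_antitoneOn measurableSet_Ioo hanti).aestronglyMeasurable
    (A (finv ν)) ?_
  refine (MeasureTheory.ae_restrict_iff' measurableSet_Ioo).2 (.of_forall fun θ hθ => ?_)
  rw [norm_of_nonneg (hA0 _ (hx θ hθ))]
  exact hA (inverse_mem_Ioo ha hfinv hf0 hν) (hx θ hθ)
    (strictMonoOn_inverse hmono hfinv hν (hy θ hθ) (angleHeight_mem_Ioo hν hθ).1).le

end HalfPeriod

/-- Let `f : [0,π/2] → [0,∞)` be smooth with `f 0 = 0`, `f' > 0` on `(0,π/2)`, `f'(π/2) = 0`,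
and set `a := f (π/2)`.  The half period function is
`φ ν = 2 ∫_{f⁻¹(ν)}^{π/2} ν / (f x √(f x ² − ν²)) dx` for `ν ∈ (0,a)`.
If `A x := √(a² − f x ²)/f' x` is monotonically decreasing on `(0,π/2)`, then `φ` is
monotonically decreasing on `(0,a)`; if moreover `A` is strictly decreasing, then `φ` is
strictly decreasing on `(0,a)`. -/
theorem half_period_antitone_of_A_antitone
    (f : ℝ → ℝ) (a : ℝ)
    (hf : ContDiff ℝ (⊤ : ℕ∞) f)
    (hf0 : f 0 = 0)
    (hfnonneg : ∀ x ∈ Set.Icc 0 (π / 2), 0 ≤ f x)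
    (hf' : ∀ x ∈ Set.Ioo 0 (π / 2), 0 < deriv f x)
    (hf'pi : deriv f (π / 2) = 0)
    (ha : a = f (π / 2))
    (finv : ℝ → ℝ)
    (hfinv : ∀ ν ∈ Set.Ioo 0 a, finv ν ∈ Set.Icc 0 (π / 2) ∧ f (finv ν) = ν)
    (φ : ℝ → ℝ)
    (hφ : ∀ ν ∈ Set.Ioo 0 a,
      φ ν = 2 * ∫ x in (finv ν)..(π / 2), ν / (f x * Real.sqrt ((f x) ^ 2 - ν ^ 2)))
    (A : ℝ → ℝ)
    (hA : ∀ x, A x = Real.sqrt (a ^ 2 - (f x) ^ 2) / deriv f x) :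
    (AntitoneOn A (Set.Ioo 0 (π / 2)) → AntitoneOn φ (Set.Ioo 0 a)) ∧
    (StrictAntiOn A (Set.Ioo 0 (π / 2)) → StrictAntiOn φ (Set.Ioo 0 a)) := by
  have hd : Differentiable ℝ f := hf.differentiable (by simp)
  have hmono : StrictMonoOn f (Icc 0 (π / 2)) :=
    strictMonoOn_of_deriv_pos (convex_Icc _ _) hd.continuous.continuousOn (by simpa using hf')
  have hA0 : ∀ x ∈ Ioo 0 (π / 2), 0 ≤ A x := fun x hx => by
    rw [hA]
    exact div_nonneg (sqrt_nonneg _) (hf' x hx).le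
  have hφ' : ∀ ν ∈ Ioo 0 a,
      φ ν = 2 / a * ∫ θ in 0..π / 2, A (finv (angleHeight ν a θ)) := fun ν hν => by
    have ha0 : a ≠ 0 := (hν.1.trans hν.2).ne'
    rw [hφ ν hν, integral_half_period_eq hd hf0 hmono hf' ha hfinv hA hν]
    field_simp
  have hx : ∀ ν ∈ Ioo 0 a, ∀ θ ∈ Ioo 0 (π / 2),
      finv (angleHeight ν a θ) ∈ Ioo 0 (π / 2) := fun ν hν θ hθ =>
    inverse_mem_Ioo ha hfinv hf0
      (Ioo_subset_Ioo_left hν.1.le (angleHeight_mem_Ioo hν hθ))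
  have hlt : ∀ ν ∈ Ioo 0 a, ∀ μ ∈ Ioo 0 a, ν < μ → ∀ θ ∈ Ioo 0 (π / 2),
      finv (angleHeight ν a θ) < finv (angleHeight μ a θ) := fun ν hν μ hμ hνμ θ hθ =>
    strictMonoOn_inverse hmono hfinv
      (Ioo_subset_Ioo_left hν.1.le (angleHeight_mem_Ioo hν hθ))
      (Ioo_subset_Ioo_left hμ.1.le (angleHeight_mem_Ioo hμ hθ))
      (angleHeight_lt_angleHeight hν.1 hνμ (hν.1.trans hν.2) hθ)
  constructor
  · intro hanti ν hν μ hμ hνμ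
    rcases hνμ.eq_or_lt with rfl | hνμ
    · exact le_rfl
    have ha0 : 0 < a := hν.1.trans hν.2
    rw [hφ' ν hν, hφ' μ hμ]
    refine mul_le_mul_of_nonneg_left ?_ (by positivity)
    exact intervalIntegral.integral_mono_on_of_le_Ioo (by positivity)
      (intervalIntegrable_comp_angleHeight hf0 hmono ha hfinv hA0 hanti hμ)
      (intervalIntegrable_comp_angleHeight hf0 hmono ha hfinv hA0 hanti hν)
      fun θ hθ => hanti (hx ν hν θ hθ) (hx μ hμ θ hθ) (hlt ν hν μ hμ hνμ θ hθ).le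
  · intro hanti ν hν μ hμ hνμ
    have ha0 : 0 < a := hν.1.trans hν.2
    rw [hφ' ν hν, hφ' μ hμ]
    refine mul_lt_mul_of_pos_left ?_ (by positivity)
    have iν := intervalIntegrable_comp_angleHeight hf0 hmono ha hfinv hA0 hanti.antitoneOn hν
    have iμ := intervalIntegrable_comp_angleHeight hf0 hmono ha hfinv hA0 hanti.antitoneOn hμ
    rw [← sub_pos, ← intervalIntegral.integral_sub iν iμ]
    exact intervalIntegral.intervalIntegral_pos_of_pos_on (iν.sub iμ)
      (fun θ hθ => sub_pos.2 <|
        hanti (hx ν hν θ hθ) (hx μ hμ θ hθ) (hlt ν hν μ hμ hνμ θ hθ))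
      (by positivity)
end

section
/- Suppose the function A(x) := √(a² − f(x)²)/f'(x) is monotonically increasing on (0, π/2). Then the half period function φ_f is monotonically increasing on (0, a). Moreover, if A is strictly increasing on (0, π/2), then φ_f is strictly increasing on (0, a). -/
open Real Set

/-- The height `y` for which `1 / y ^ 2` is the convex combination of `1 / ν ^ 2` and `1 / a ^ 2`
with weights `cos θ ^ 2` and `sin θ ^ 2`. -/
noncomputable def level (a ν θ : ℝ) : ℝ := 1 / √(cos θ ^ 2 / ν ^ 2 + sin θ ^ 2 / a ^ 2)

/-- The inverse of `level a ν`, as a function from `(ν, a)` to `(0, π / 2)`. -/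
noncomputable def phase (a ν y : ℝ) : ℝ :=
  arccos (1 - 2 * ((1 / ν ^ 2 - 1 / y ^ 2) / (1 / ν ^ 2 - 1 / a ^ 2))) / 2

lemma one_div_sq_lt {u v : ℝ} (hu : 0 < u) (huv : u < v) : 1 / v ^ 2 < 1 / u ^ 2 :=
  one_div_lt_one_div_of_lt (by positivity) (pow_lt_pow_left₀ huv hu.le two_ne_zero)

lemma level_pos {a ν : ℝ} (hν : 0 < ν) (hνa : ν < a) (θ : ℝ) : 0 < level a ν θ := by
  have ha : 0 < a := hν.trans hνa
  have h1 := one_div_sq_lt hν hνa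
  have h2 : 0 < 1 / a ^ 2 := by positivity
  have h3 := sin_sq_add_cos_sq θ
  have : 0 < cos θ ^ 2 / ν ^ 2 + sin θ ^ 2 / a ^ 2 := by
    have : cos θ ^ 2 / ν ^ 2 + sin θ ^ 2 / a ^ 2
        = cos θ ^ 2 * (1 / ν ^ 2 - 1 / a ^ 2) + (sin θ ^ 2 + cos θ ^ 2) * (1 / a ^ 2) := by ring
    rw [this, h3]
    nlinarith [sq_nonneg (cos θ)]
  unfold level
  positivity

lemma one_div_level_sq {a ν : ℝ} (θ : ℝ) :
    1 / level a ν θ ^ 2 = cos θ ^ 2 / ν ^ 2 + sin θ ^ 2 / a ^ 2 := by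
  rw [level, div_pow, one_pow, one_div_one_div, sq_sqrt (by positivity)]

lemma lt_of_one_div_sq_lt {u v : ℝ} (hv : 0 < v) (h : 1 / v ^ 2 < 1 / u ^ 2) :
    u < v :=
  lt_of_pow_lt_pow_left₀ 2 hv.le (lt_of_one_div_lt_one_div (by positivity) h)

lemma cos_sq_pos_of_mem {θ : ℝ} (hθ : θ ∈ Ioo 0 (π / 2)) : 0 < cos θ ^ 2 :=
  pow_pos (cos_pos_of_mem_Ioo ⟨by linarith [hθ.1, pi_pos], hθ.2⟩) 2

lemma sin_sq_pos_of_mem {θ : ℝ} (hθ : θ ∈ Ioo 0 (π / 2)) : 0 < sin θ ^ 2 :=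
  pow_pos (sin_pos_of_mem_Ioo ⟨hθ.1, by linarith [hθ.2, pi_pos]⟩) 2

lemma level_mem_Ioo {a ν θ : ℝ} (hν : 0 < ν) (hνa : ν < a) (hθ : θ ∈ Ioo 0 (π / 2)) :
    level a ν θ ∈ Ioo ν a := by
  have h1 := one_div_sq_lt hν hνa
  have hc := cos_sq_pos_of_mem hθ
  have hs := sin_sq_pos_of_mem hθ
  have h3 := sin_sq_add_cos_sq θ
  have hl := one_div_level_sq (a := a) (ν := ν) θ
  have e1 : cos θ ^ 2 / ν ^ 2 + sin θ ^ 2 / a ^ 2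
      = (sin θ ^ 2 + cos θ ^ 2) * (1 / ν ^ 2) - sin θ ^ 2 * (1 / ν ^ 2 - 1 / a ^ 2) := by ring
  have e2 : cos θ ^ 2 / ν ^ 2 + sin θ ^ 2 / a ^ 2
      = (sin θ ^ 2 + cos θ ^ 2) * (1 / a ^ 2) + cos θ ^ 2 * (1 / ν ^ 2 - 1 / a ^ 2) := by ring
  rw [h3, one_mul] at e1 e2
  refine ⟨lt_of_one_div_sq_lt (level_pos hν hνa θ) ?_,
    lt_of_one_div_sq_lt (hν.trans hνa) ?_⟩
  · rw [hl, e1]; nlinarith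
  · rw [hl, e2]; nlinarith

lemma level_lt_level {a ν₁ ν₂ θ : ℝ} (hν₁ : 0 < ν₁) (h : ν₁ < ν₂) (hνa : ν₂ < a)
    (hθ : θ ∈ Ioo 0 (π / 2)) : level a ν₁ θ < level a ν₂ θ := by
  refine lt_of_one_div_sq_lt (level_pos (hν₁.trans h) hνa θ) ?_
  rw [one_div_level_sq, one_div_level_sq, div_eq_mul_one_div (cos θ ^ 2) (ν₂ ^ 2),
    div_eq_mul_one_div (cos θ ^ 2) (ν₁ ^ 2)]
  nlinarith [one_div_sq_lt hν₁ h, cos_sq_pos_of_mem hθ]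

lemma phase_ratio_mem_Ioo {a ν y : ℝ} (hν : 0 < ν) (hy : y ∈ Ioo ν a) :
    (1 / ν ^ 2 - 1 / y ^ 2) / (1 / ν ^ 2 - 1 / a ^ 2) ∈ Ioo (0 : ℝ) 1 := by
  have h1 := one_div_sq_lt hν hy.1
  have h2 := one_div_sq_lt (hν.trans hy.1) hy.2
  exact ⟨div_pos (by linarith) (by linarith), (div_lt_one (by linarith)).2 (by linarith)⟩

lemma phase_mem_Ioo {a ν y : ℝ} (hν : 0 < ν) (hy : y ∈ Ioo ν a) :
    phase a ν y ∈ Ioo 0 (π / 2) := by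
  obtain ⟨h0, h1⟩ := phase_ratio_mem_Ioo hν hy
  rw [phase]
  set w := (1 / ν ^ 2 - 1 / y ^ 2) / (1 / ν ^ 2 - 1 / a ^ 2)
  have hpos : 0 < arccos (1 - 2 * w) := arccos_pos.2 (by linarith)
  have hlt : arccos (1 - 2 * w) < π :=
    lt_of_le_of_ne (arccos_le_pi _) fun h => by linarith [arccos_eq_pi.1 h]
  exact ⟨by linarith, by linarith⟩

lemma level_phase {a ν y : ℝ} (hν : 0 < ν) (hy : y ∈ Ioo ν a) :
    level a ν (phase a ν y) = y := by
  have hy0 : 0 < y := hν.trans hy.1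
  have hD : 1 / ν ^ 2 - 1 / a ^ 2 ≠ 0 :=
    (sub_pos.2 (one_div_sq_lt hν (hy.1.trans hy.2))).ne'
  obtain ⟨h0, h1⟩ := phase_ratio_mem_Ioo hν hy
  have hc : cos (2 * phase a ν y)
      = 1 - 2 * ((1 / ν ^ 2 - 1 / y ^ 2) / (1 / ν ^ 2 - 1 / a ^ 2)) := by
    rw [phase, mul_div_cancel₀ _ two_ne_zero, cos_arccos (by linarith) (by linarith)]
  have hc2 := hc
  rw [cos_two_mul] at hc2
  have hcc : cos (phase a ν y) ^ 2
      = 1 - (1 / ν ^ 2 - 1 / y ^ 2) / (1 / ν ^ 2 - 1 / a ^ 2) := by linarith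
  have hss : sin (phase a ν y) ^ 2
      = (1 / ν ^ 2 - 1 / y ^ 2) / (1 / ν ^ 2 - 1 / a ^ 2) := by rw [sin_sq, hcc]; ring
  have hl := one_div_level_sq (a := a) (ν := ν) (phase a ν y)
  have hE : 1 / level a ν (phase a ν y) ^ 2 = 1 / y ^ 2 := by
    rw [hl, div_eq_mul_one_div, div_eq_mul_one_div (sin _ ^ 2), hcc, hss]
    have := div_mul_cancel₀ (1 / ν ^ 2 - 1 / y ^ 2) hD
    linear_combination -this
  have hlp := level_pos hν (hy.1.trans hy.2) (phase a ν y)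
  rw [one_div, one_div] at hE
  exact (pow_left_inj₀ hlp.le hy0.le two_ne_zero).1 (inv_injective hE)

lemma phase_level {a ν θ : ℝ} (hν : 0 < ν) (hνa : ν < a) (hθ : θ ∈ Ioo 0 (π / 2)) :
    phase a ν (level a ν θ) = θ := by
  have hD : 1 / ν ^ 2 - 1 / a ^ 2 ≠ 0 := (sub_pos.2 (one_div_sq_lt hν hνa)).ne'
  have h : (1 / ν ^ 2 - 1 / level a ν θ ^ 2) / (1 / ν ^ 2 - 1 / a ^ 2) = sin θ ^ 2 := by
    rw [div_eq_iff hD, one_div_level_sq, cos_sq']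
    ring
  rw [phase, h, show 1 - 2 * sin θ ^ 2 = cos (2 * θ) by rw [cos_two_mul, sin_sq]; ring,
    arccos_cos (by linarith [hθ.1]) (by linarith [hθ.2])]
  ring

lemma hasDerivAt_phase {a ν y : ℝ} (hν : 0 < ν) (hy : y ∈ Ioo ν a) :
    HasDerivAt (phase a ν) (a * ν / (y * √(y ^ 2 - ν ^ 2) * √(a ^ 2 - y ^ 2))) y := by
  have hy0 : 0 < y := hν.trans hy.1
  have ha : 0 < a := hy0.trans hy.2
  have hp : 0 < y ^ 2 - ν ^ 2 := by nlinarith [hy.1]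
  have hq : 0 < a ^ 2 - y ^ 2 := by nlinarith [hy.2]
  have hr : 0 < a ^ 2 - ν ^ 2 := by linarith
  obtain ⟨h0, h1⟩ := phase_ratio_mem_Ioo hν hy
  have hinner : HasDerivAt
      (fun y : ℝ => 1 - 2 * ((1 / ν ^ 2 - 1 / y ^ 2) / (1 / ν ^ 2 - 1 / a ^ 2)))
      (-(4 * a ^ 2 * ν ^ 2 / (y ^ 3 * (a ^ 2 - ν ^ 2)))) y := by
    have hi : HasDerivAt (fun y : ℝ => 1 / y ^ 2) (-(2 / y ^ 3)) y := by
      simp only [one_div]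
      refine ((hasDerivAt_pow 2 y).fun_inv (by positivity)).congr_deriv ?_
      field_simp
      norm_num [mul_comm]
    refine ((((hi.const_sub (1 / ν ^ 2)).div_const
      (1 / ν ^ 2 - 1 / a ^ 2)).const_mul 2).const_sub 1).congr_deriv ?_
    have : 1 / ν ^ 2 - 1 / a ^ 2 = (a ^ 2 - ν ^ 2) / (ν ^ 2 * a ^ 2) := by field_simp
    rw [this]
    field_simp
    ring
  have hcomp := ((hasDerivAt_arccos (by linarith) (by linarith)).comp y hinner).div_const 2
  refine hcomp.congr_deriv ?_
  have hs : √(1 - (1 - 2 * ((1 / ν ^ 2 - 1 / y ^ 2) / (1 / ν ^ 2 - 1 / a ^ 2))) ^ 2)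
      = 2 * a * ν * (√(y ^ 2 - ν ^ 2) * √(a ^ 2 - y ^ 2)) / (y ^ 2 * (a ^ 2 - ν ^ 2)) := by
    rw [sqrt_eq_iff_mul_self_eq_of_pos (by positivity)]
    have e1 := mul_self_sqrt hp.le
    have e2 := mul_self_sqrt hq.le
    have : 1 / ν ^ 2 - 1 / a ^ 2 = (a ^ 2 - ν ^ 2) / (ν ^ 2 * a ^ 2) := by field_simp
    rw [this]
    have e3 : 2 * a * ν * (√(y ^ 2 - ν ^ 2) * √(a ^ 2 - y ^ 2)) / (y ^ 2 * (a ^ 2 - ν ^ 2)) *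
        (2 * a * ν * (√(y ^ 2 - ν ^ 2) * √(a ^ 2 - y ^ 2)) / (y ^ 2 * (a ^ 2 - ν ^ 2))) =
        4 * a ^ 2 * ν ^ 2 * ((√(y ^ 2 - ν ^ 2) * √(y ^ 2 - ν ^ 2)) *
          (√(a ^ 2 - y ^ 2) * √(a ^ 2 - y ^ 2))) / (y ^ 2 * (a ^ 2 - ν ^ 2)) ^ 2 := by
      rw [div_mul_div_comm, ← sq (y ^ 2 * _)]
      congr 1
      ring
    rw [e3, e1, e2]
    field_simp
    ring
  rw [hs]
  have := sqrt_pos.2 hp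
  have := sqrt_pos.2 hq
  field_simp
  ring

open MeasureTheory

lemma integrableOn_half_period_integrand {f : ℝ → ℝ} {x₀ b ν : ℝ} (hf : Differentiable ℝ f)
    (hmono : StrictMonoOn f (Icc x₀ b)) (hx₀ : x₀ < b) (hder : 0 < deriv f x₀) (hν : 0 < ν)
    (hfx₀ : f x₀ = ν) :
    IntegrableOn (fun x => ν / (f x * √(f x ^ 2 - ν ^ 2))) (Ioo x₀ b) := by
  have hcont : ContinuousOn (dslope f x₀) (Icc x₀ b) :=
    ((continuousOn_dslope Filter.univ_mem).2
      ⟨hf.continuous.continuousOn, hf x₀⟩).mono (subset_univ _)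
  obtain ⟨m, hm, hmin⟩ := isCompact_Icc.exists_isMinOn (nonempty_Icc.2 hx₀.le) hcont
  have hc : 0 < dslope f x₀ m := by
    rcases hm.1.eq_or_lt with h | h
    · rw [← h, dslope_same]
      exact hder
    · rw [dslope_of_ne _ h.ne', slope_def_field]
      exact div_pos (sub_pos.2 (hmono (left_mem_Icc.2 hx₀.le) hm h)) (sub_pos.2 h)
  set c := dslope f x₀ m
  have hgt : ∀ x ∈ Ioo x₀ b, ν < f x := fun x hx =>
    hfx₀ ▸ hmono (left_mem_Icc.2 hx₀.le) (Ioo_subset_Icc_self hx) hx.1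
  have hlower : ∀ x ∈ Ioo x₀ b, c * ν * (x - x₀) ≤ f x ^ 2 - ν ^ 2 := by
    intro x hx
    have h1 : c ≤ dslope f x₀ x := hmin (Ioo_subset_Icc_self hx)
    have h2 : (x - x₀) * dslope f x₀ x = f x - f x₀ := sub_smul_dslope f x₀ x
    have h3 : c * (x - x₀) ≤ f x - ν := by
      rw [← hfx₀, ← h2, mul_comm]
      exact mul_le_mul_of_nonneg_left h1 (sub_nonneg.2 hx.1.le)
    nlinarith [hgt x hx]
  have hbound : IntegrableOn (fun x => (√(c * ν))⁻¹ * (x - x₀) ^ (-(1 / 2) : ℝ)) (Ioo x₀ b) := by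
    have h := ((intervalIntegral.intervalIntegrable_rpow' (a := x₀ - x₀) (b := b - x₀)
      (r := -(1 / 2)) (by norm_num)).comp_sub_right x₀).const_mul (√(c * ν))⁻¹
    simp only [sub_add_cancel] at h
    exact (intervalIntegrable_iff_integrableOn_Ioc_of_le hx₀.le).1 h |>.mono_set
      Ioo_subset_Ioc_self
  refine hbound.mono' ?_ ?_
  · refine ContinuousOn.aestronglyMeasurable ?_ measurableSet_Ioo
    have := hf.continuous
    refine continuousOn_const.div (by fun_prop) fun x hx => ?_
    have h1 := hgt x hx
    have h2 : 0 < f x ^ 2 - ν ^ 2 := by nlinarith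
    exact (mul_pos (hν.trans h1) (sqrt_pos.2 h2)).ne'
  · refine (ae_restrict_iff' measurableSet_Ioo).2 (Filter.Eventually.of_forall fun x hx => ?_)
    have h1 := hgt x hx
    have hd : 0 < x - x₀ := sub_pos.2 hx.1
    have hfx : 0 < f x := hν.trans h1
    have hsq : √(c * ν) * √(x - x₀) ≤ √(f x ^ 2 - ν ^ 2) := by
      rw [← sqrt_mul (by positivity)]
      exact sqrt_le_sqrt (hlower x hx)
    have hpos : 0 < √(c * ν) * √(x - x₀) := by positivity
    rw [norm_of_nonneg (by positivity), rpow_neg hd.le, ← sqrt_eq_rpow, ← mul_inv,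
      ← div_div, div_eq_mul_inv]
    calc ν / f x * (√(f x ^ 2 - ν ^ 2))⁻¹ ≤ 1 * (√(c * ν) * √(x - x₀))⁻¹ := by
          gcongr
          exact (div_le_one hfx).2 h1.le
      _ = _ := one_mul _

lemma half_period_change_of_variables_s1 {f finv : ℝ → ℝ} {a b ν : ℝ} (hf : Differentiable ℝ f)
    (hmono : StrictMonoOn f (Icc 0 b)) (hf' : ∀ x ∈ Ioo 0 b, 0 < deriv f x) (hf0 : f 0 = 0)
    (ha : a = f b) (hfinv : ∀ y ∈ Ioo 0 a, finv y ∈ Icc 0 b ∧ f (finv y) = y)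
    (hν : ν ∈ Ioo 0 a) :
    IntegrableOn (fun θ => √(a ^ 2 - f (finv (level a ν θ)) ^ 2) / deriv f (finv (level a ν θ)))
      (Ioo 0 (π / 2)) ∧
    ∫ x in Ioo (finv ν) b, ν / (f x * √(f x ^ 2 - ν ^ 2)) =
      1 / a * ∫ θ in Ioo 0 (π / 2),
        √(a ^ 2 - f (finv (level a ν θ)) ^ 2) / deriv f (finv (level a ν θ)) := by
  obtain ⟨hν0, hνa⟩ := hν
  have ha0 : 0 < a := hν0.trans hνa
  obtain ⟨hx₀, hfx₀⟩ := hfinv ν ⟨hν0, hνa⟩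
  have hpos : 0 < finv ν := hx₀.1.lt_of_ne fun h => by
    rw [← h, hf0] at hfx₀
    exact hν0.ne hfx₀
  have hlt : finv ν < b := hx₀.2.lt_of_ne fun h => by
    rw [h, ← ha] at hfx₀
    exact hνa.ne' hfx₀
  have hb : b ∈ Icc 0 b := right_mem_Icc.2 (hpos.trans hlt).le
  have hmem : ∀ x ∈ Ioo (finv ν) b, f x ∈ Ioo ν a := fun x hx =>
    ⟨hfx₀ ▸ hmono hx₀ ⟨(hpos.trans hx.1).le, hx.2.le⟩ hx.1,
      ha ▸ hmono ⟨(hpos.trans hx.1).le, hx.2.le⟩ hb hx.2⟩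
  have hfinv_f : ∀ x ∈ Ioo (finv ν) b, finv (f x) = x := fun x hx => by
    have h := hfinv (f x) ⟨hν0.trans (hmem x hx).1, (hmem x hx).2⟩
    exact hmono.injOn h.1 ⟨(hpos.trans hx.1).le, hx.2.le⟩ h.2
  have hinv : ∀ x ∈ Ioo (finv ν) b, finv (level a ν (phase a ν (f x))) = x := fun x hx => by
    rw [level_phase hν0 (hmem x hx), hfinv_f x hx]
  have hinj : InjOn (fun x => phase a ν (f x)) (Ioo (finv ν) b) :=
    LeftInvOn.injOn (f₁' := fun θ => finv (level a ν θ)) hinv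
  have himage : (fun x => phase a ν (f x)) '' Ioo (finv ν) b = Ioo 0 (π / 2) := by
    refine Subset.antisymm ?_ fun θ hθ => ?_
    · rintro _ ⟨x, hx, rfl⟩
      exact phase_mem_Ioo hν0 (hmem x hx)
    · have hl := level_mem_Ioo hν0 hνa hθ
      obtain ⟨hy, hfy⟩ := hfinv _ ⟨hν0.trans hl.1, hl.2⟩
      refine ⟨finv (level a ν θ), ⟨?_, hy.2.lt_of_ne fun h => ?_⟩, ?_⟩
      · rw [← hmono.lt_iff_lt hx₀ hy, hfx₀, hfy]
        exact hl.1
      · rw [h, ← ha] at hfy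
        exact hl.2.ne' hfy
      · simp only [hfy, phase_level hν0 hνa hθ]
  have hderiv : ∀ x ∈ Ioo (finv ν) b, HasDerivWithinAt (fun x => phase a ν (f x))
      (a * ν / (f x * √(f x ^ 2 - ν ^ 2) * √(a ^ 2 - f x ^ 2)) * deriv f x)
      (Ioo (finv ν) b) x := fun x hx =>
    ((hasDerivAt_phase hν0 (hmem x hx)).comp x (hf x).hasDerivAt).hasDerivWithinAt
  have hcongr : EqOn (fun x =>
      |a * ν / (f x * √(f x ^ 2 - ν ^ 2) * √(a ^ 2 - f x ^ 2)) * deriv f x| •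
        (√(a ^ 2 - f (finv (level a ν (phase a ν (f x)))) ^ 2) /
          deriv f (finv (level a ν (phase a ν (f x))))))
      (fun x => a * (ν / (f x * √(f x ^ 2 - ν ^ 2)))) (Ioo (finv ν) b) := by
    intro x hx
    obtain ⟨h1, h2⟩ := hmem x hx
    have hfx : 0 < f x := hν0.trans h1
    have hd := hf' x ⟨hpos.trans hx.1, hx.2⟩
    have hp : 0 < √(f x ^ 2 - ν ^ 2) := sqrt_pos.2 (by nlinarith)
    have hq : 0 < √(a ^ 2 - f x ^ 2) := sqrt_pos.2 (by nlinarith)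
    simp only [hinv x hx, smul_eq_mul]
    rw [abs_of_pos (by positivity)]
    field_simp
  constructor
  · rw [← himage, integrableOn_image_iff_integrableOn_abs_deriv_smul measurableSet_Ioo hderiv hinj,
      integrableOn_congr_fun hcongr measurableSet_Ioo]
    exact (integrableOn_half_period_integrand hf
      (hmono.mono (Icc_subset_Icc_left hx₀.1)) hlt (hf' _ ⟨hpos, hlt⟩) hν0 hfx₀).const_mul a
  · rw [← himage, integral_image_eq_integral_abs_deriv_smul measurableSet_Ioo hderiv hinj,
      setIntegral_congr_fun measurableSet_Ioo hcongr, integral_const_mul]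
    field_simp

/-- Let `f : [0,π/2] → [0,∞)` be smooth with `f 0 = 0`, `f' > 0` on `(0,π/2)`, `f'(π/2) = 0`,
and set `a := f (π/2)`.  The half period function is
`φ ν = 2 ∫_{f⁻¹(ν)}^{π/2} ν / (f x √(f x ² − ν²)) dx` for `ν ∈ (0,a)`.
If `A x := √(a² − f x ²)/f' x` is monotonically increasing on `(0,π/2)`, then `φ` is
monotonically increasing on `(0,a)`; if moreover `A` is strictly increasing, then `φ` is
strictly increasing on `(0,a)`. -/
theorem half_period_monotone_of_A_monotone
    (f : ℝ → ℝ) (a : ℝ)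
    (hf : ContDiff ℝ (⊤ : ℕ∞) f)
    (hf0 : f 0 = 0)
    (hfnonneg : ∀ x ∈ Set.Icc 0 (π / 2), 0 ≤ f x)
    (hf' : ∀ x ∈ Set.Ioo 0 (π / 2), 0 < deriv f x)
    (hf'pi : deriv f (π / 2) = 0)
    (ha : a = f (π / 2))
    (finv : ℝ → ℝ)
    (hfinv : ∀ ν ∈ Set.Ioo 0 a, finv ν ∈ Set.Icc 0 (π / 2) ∧ f (finv ν) = ν)
    (φ : ℝ → ℝ)
    (hφ : ∀ ν ∈ Set.Ioo 0 a,
      φ ν = 2 * ∫ x in (finv ν)..(π / 2), ν / (f x * Real.sqrt ((f x) ^ 2 - ν ^ 2)))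
    (A : ℝ → ℝ)
    (hA : ∀ x, A x = Real.sqrt (a ^ 2 - (f x) ^ 2) / deriv f x) :
    (MonotoneOn A (Set.Ioo 0 (π / 2)) → MonotoneOn φ (Set.Ioo 0 a)) ∧
    (StrictMonoOn A (Set.Ioo 0 (π / 2)) → StrictMonoOn φ (Set.Ioo 0 a)) := by
  have hb : 0 < π / 2 := by positivity
  have hdiff : Differentiable ℝ f := hf.differentiable (by simp)
  have hmono : StrictMonoOn f (Icc 0 (π / 2)) :=
    strictMonoOn_of_deriv_pos (convex_Icc _ _) hf.continuous.continuousOn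
      (by rwa [interior_Icc])
  have hinv : ∀ y ∈ Ioo 0 a, finv y ∈ Ioo 0 (π / 2) := by
    intro y hy
    obtain ⟨⟨h0, h1⟩, hfy⟩ := hfinv y hy
    refine ⟨h0.lt_of_ne fun h => ?_, h1.lt_of_ne fun h => ?_⟩
    · rw [← h, hf0] at hfy
      exact hy.1.ne hfy
    · rw [h, ← ha] at hfy
      exact hy.2.ne' hfy
  have hinv_mono : ∀ y ∈ Ioo 0 a, ∀ z ∈ Ioo 0 a, y < z → finv y < finv z := by
    intro y hy z hz hyz
    rw [← hmono.lt_iff_lt (hfinv y hy).1 (hfinv z hz).1, (hfinv y hy).2, (hfinv z hz).2]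
    exact hyz
  have hA' : A = fun x => √(a ^ 2 - f x ^ 2) / deriv f x := funext hA
  have hlevel : ∀ ν ∈ Ioo 0 a, ∀ θ ∈ Ioo 0 (π / 2), level a ν θ ∈ Ioo 0 a := fun ν hν θ hθ =>
    ⟨level_pos hν.1 hν.2 θ, (level_mem_Ioo hν.1 hν.2 hθ).2⟩
  have hint : ∀ ν ∈ Ioo 0 a,
      IntervalIntegrable (fun θ => A (finv (level a ν θ))) volume 0 (π / 2) := by
    intro ν hν
    rw [intervalIntegrable_iff_integrableOn_Ioo_of_le hb.le, hA']
    exact (half_period_change_of_variables_s1 hdiff hmono hf' hf0 ha hfinv hν).1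
  have hφA : ∀ ν ∈ Ioo 0 a, φ ν = 2 / a * ∫ θ in (0)..(π / 2), A (finv (level a ν θ)) := by
    intro ν hν
    rw [hφ ν hν, intervalIntegral.integral_of_le (hinv ν hν).2.le,
      intervalIntegral.integral_of_le hb.le, integral_Ioc_eq_integral_Ioo,
      integral_Ioc_eq_integral_Ioo, hA',
      (half_period_change_of_variables_s1 hdiff hmono hf' hf0 ha hfinv hν).2]
    ring
  have hlt : ∀ ν₁ ∈ Ioo 0 a, ∀ ν₂ ∈ Ioo 0 a, ν₁ < ν₂ → ∀ θ ∈ Ioo 0 (π / 2),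
      finv (level a ν₁ θ) < finv (level a ν₂ θ) := fun ν₁ h₁ ν₂ h₂ h θ hθ =>
    hinv_mono _ (hlevel ν₁ h₁ θ hθ) _ (hlevel ν₂ h₂ θ hθ) (level_lt_level h₁.1 h h₂.2 hθ)
  refine ⟨fun hAm ν₁ h₁ ν₂ h₂ h => ?_, fun hAm ν₁ h₁ ν₂ h₂ h => ?_⟩
  · rcases h.eq_or_lt with rfl | h
    · exact le_rfl
    have ha0 : 0 < a := h₁.1.trans h₁.2
    rw [hφA ν₁ h₁, hφA ν₂ h₂]
    refine mul_le_mul_of_nonneg_left ?_ (by positivity)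
    exact intervalIntegral.integral_mono_on_of_le_Ioo hb.le (hint ν₁ h₁) (hint ν₂ h₂)
      fun θ hθ => hAm (hinv _ (hlevel ν₁ h₁ θ hθ)) (hinv _ (hlevel ν₂ h₂ θ hθ))
        (hlt ν₁ h₁ ν₂ h₂ h θ hθ).le
  · have ha0 : 0 < a := h₁.1.trans h₁.2
    rw [hφA ν₁ h₁, hφA ν₂ h₂]
    refine mul_lt_mul_of_pos_left ?_ (by positivity)
    rw [← sub_pos, ← intervalIntegral.integral_sub (hint ν₂ h₂) (hint ν₁ h₁)]
    exact intervalIntegral.intervalIntegral_pos_of_pos_on ((hint ν₂ h₂).sub (hint ν₁ h₁))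
      (fun θ hθ => sub_pos.2 (hAm (hinv _ (hlevel ν₁ h₁ θ hθ)) (hinv _ (hlevel ν₂ h₂ θ hθ))
        (hlt ν₁ h₁ ν₂ h₂ h θ hθ))) hb
end

section
/- For every ν ∈ (0,a), the half period function satisfies the change-of-variables identity φ_f(ν) = 2∫₀^∞ A(f⁻¹(√(u(τ,ν))))·(a²τ² + 1)⁻¹ dτ, where u(τ,ν) := ν²(a²τ² + 1)/(ν²τ² + 1) and A(x) := √(a² − f(x)²)/f'(x); both sides are integrals of nonnegative functions and the equality holds as an equality of (possibly infinite) Lebesgue integrals. -/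
open Real Set MeasureTheory

/-- The substitution `w = √(u(τ,ν))`. -/
noncomputable def halfPeriodSubst (a ν τ : ℝ) : ℝ :=
  Real.sqrt (ν ^ 2 * (a ^ 2 * τ ^ 2 + 1) / (ν ^ 2 * τ ^ 2 + 1))

/-- The inverse `τ` of the substitution `w = √(u(τ,ν))`. -/
noncomputable def halfPeriodSubstInv (a ν w : ℝ) : ℝ :=
  Real.sqrt (w ^ 2 - ν ^ 2) / (ν * Real.sqrt (a ^ 2 - w ^ 2))

lemma sq_halfPeriodSubstInv {a ν w : ℝ} (hν : 0 < ν) (hw : w ∈ Set.Ioo ν a) :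
    halfPeriodSubstInv a ν w ^ 2 = (w ^ 2 - ν ^ 2) / (ν ^ 2 * (a ^ 2 - w ^ 2)) := by
  obtain ⟨h1, h2⟩ := hw
  rw [halfPeriodSubstInv, div_pow, mul_pow, Real.sq_sqrt (by nlinarith),
    Real.sq_sqrt (by nlinarith)]

lemma halfPeriodSubstInv_pos {a ν w : ℝ} (hν : 0 < ν) (hw : w ∈ Set.Ioo ν a) :
    0 < halfPeriodSubstInv a ν w := by
  obtain ⟨h1, h2⟩ := hw
  have h3 : 0 < w ^ 2 - ν ^ 2 := by nlinarith
  have h4 : 0 < a ^ 2 - w ^ 2 := by nlinarith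
  rw [halfPeriodSubstInv]
  positivity

lemma halfPeriodSubst_substInv {a ν w : ℝ} (hν : 0 < ν) (hw : w ∈ Set.Ioo ν a) :
    halfPeriodSubst a ν (halfPeriodSubstInv a ν w) = w := by
  have hsq := sq_halfPeriodSubstInv hν hw
  obtain ⟨h1, h2⟩ := hw
  have h3 : 0 < a ^ 2 - w ^ 2 := by nlinarith
  have h4 : 0 < a ^ 2 - ν ^ 2 := by nlinarith
  have e1 : a ^ 2 * halfPeriodSubstInv a ν w ^ 2 + 1
      = w ^ 2 * (a ^ 2 - ν ^ 2) / (ν ^ 2 * (a ^ 2 - w ^ 2)) := by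
    rw [hsq]; field_simp; ring
  have e2 : ν ^ 2 * halfPeriodSubstInv a ν w ^ 2 + 1 = (a ^ 2 - ν ^ 2) / (a ^ 2 - w ^ 2) := by
    rw [hsq]; field_simp; ring
  rw [halfPeriodSubst, e1, e2, ← Real.sqrt_sq (hν.trans h1).le]
  congr 1
  rw [Real.sqrt_sq (hν.trans h1).le]
  field_simp

lemma halfPeriodSubst_mem_Ioo {a ν τ : ℝ} (hν : ν ∈ Set.Ioo 0 a) (hτ : 0 < τ) :
    halfPeriodSubst a ν τ ∈ Set.Ioo ν a := by
  obtain ⟨h1, h2⟩ := hν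
  have h3 : 0 < a ^ 2 - ν ^ 2 := by nlinarith
  have h4 : 0 < (a ^ 2 - ν ^ 2) * (ν ^ 2 * τ ^ 2) := by positivity
  constructor
  · rw [halfPeriodSubst, Real.lt_sqrt h1.le, lt_div_iff₀ (by positivity)]
    linarith
  · rw [halfPeriodSubst, Real.sqrt_lt' (by linarith), div_lt_iff₀ (by positivity)]
    linarith

lemma halfPeriodSubstInv_subst {a ν τ : ℝ} (hν : ν ∈ Set.Ioo 0 a) (hτ : 0 < τ) :
    halfPeriodSubstInv a ν (halfPeriodSubst a ν τ) = τ := by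
  have hmem := halfPeriodSubst_mem_Ioo hν hτ
  obtain ⟨h1, h2⟩ := hν
  have h3 : 0 < a ^ 2 - ν ^ 2 := by nlinarith
  have hsq : halfPeriodSubst a ν τ ^ 2
      = ν ^ 2 * (a ^ 2 * τ ^ 2 + 1) / (ν ^ 2 * τ ^ 2 + 1) := by
    rw [halfPeriodSubst, Real.sq_sqrt (by positivity)]
  have e1 : halfPeriodSubst a ν τ ^ 2 - ν ^ 2
      = ν ^ 2 * τ ^ 2 * (a ^ 2 - ν ^ 2) / (ν ^ 2 * τ ^ 2 + 1) := by
    rw [hsq]; field_simp; ring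
  have e2 : a ^ 2 - halfPeriodSubst a ν τ ^ 2 = (a ^ 2 - ν ^ 2) / (ν ^ 2 * τ ^ 2 + 1) := by
    rw [hsq]; field_simp; ring
  rw [← sq_eq_sq₀ (halfPeriodSubstInv_pos h1 hmem).le hτ.le, sq_halfPeriodSubstInv h1 hmem, e1, e2]
  field_simp

lemma hasDerivAt_halfPeriodSubstInv {a ν w : ℝ} (hν : 0 < ν) (hw : w ∈ Set.Ioo ν a) :
    HasDerivAt (halfPeriodSubstInv a ν)
      (w * (a ^ 2 - ν ^ 2) /
        (ν * Real.sqrt (w ^ 2 - ν ^ 2) * ((a ^ 2 - w ^ 2) * Real.sqrt (a ^ 2 - w ^ 2)))) w := by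
  obtain ⟨h1, h2⟩ := hw
  have h3 : 0 < w ^ 2 - ν ^ 2 := by nlinarith
  have h4 : 0 < a ^ 2 - w ^ 2 := by nlinarith
  have d1 := (((hasDerivAt_id w).pow 2).sub_const (ν ^ 2)).sqrt h3.ne'
  have d2 := ((((hasDerivAt_id w).pow 2).const_sub (a ^ 2)).sqrt h4.ne').const_mul ν
  have hS := Real.sqrt_pos.2 h3
  have hR := Real.sqrt_pos.2 h4
  refine (d1.div d2 (mul_pos hν hR).ne').congr_deriv ?_
  have hS2 := Real.sq_sqrt h3.le
  have hR2 := Real.sq_sqrt h4.le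
  simp only [id, Pi.pow_apply] at *
  set S := Real.sqrt (w ^ 2 - ν ^ 2)
  set R := Real.sqrt (a ^ 2 - w ^ 2)
  rw [← hR2, show a ^ 2 - ν ^ 2 = S ^ 2 + R ^ 2 by linarith]
  field_simp
  push_cast
  ring

/-- For every `ν ∈ (0,a)` the half period function satisfies the change-of-variables identity
`φ_f(ν) = 2 ∫₀^∞ A(f⁻¹(√(u(τ,ν)))) / (a²τ² + 1) dτ`, where
`u(τ,ν) := ν²(a²τ² + 1)/(ν²τ² + 1)` and `A x := √(a² − f x ²)/f' x`.
Both sides are integrals of nonnegative functions; the equality is stated as an equality of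
(possibly infinite) Lebesgue integrals. -/
theorem half_period_change_of_variables
    (f : ℝ → ℝ) (a : ℝ)
    (hf : ContDiff ℝ (⊤ : ℕ∞) f)
    (hf0 : f 0 = 0)
    (hfnonneg : ∀ x ∈ Set.Icc 0 (π / 2), 0 ≤ f x)
    (hf' : ∀ x ∈ Set.Ioo 0 (π / 2), 0 < deriv f x)
    (hf'pi : deriv f (π / 2) = 0)
    (ha : a = f (π / 2))
    (finv : ℝ → ℝ)
    (hfinv : ∀ ν ∈ Set.Ioo 0 a, finv ν ∈ Set.Icc 0 (π / 2) ∧ f (finv ν) = ν)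
    (A : ℝ → ℝ)
    (hA : ∀ x, A x = Real.sqrt (a ^ 2 - (f x) ^ 2) / deriv f x) :
    ∀ ν ∈ Set.Ioo 0 a,
      2 * ∫⁻ x in Set.Ioo (finv ν) (π / 2),
          ENNReal.ofReal (ν / (f x * Real.sqrt ((f x) ^ 2 - ν ^ 2)))
      = 2 * ∫⁻ τ in Set.Ioi (0 : ℝ),
          ENNReal.ofReal
            (A (finv (Real.sqrt (ν ^ 2 * (a ^ 2 * τ ^ 2 + 1) / (ν ^ 2 * τ ^ 2 + 1))))
              / (a ^ 2 * τ ^ 2 + 1)) := by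
  intro ν hν
  congr 1
  have hmono : StrictMonoOn f (Set.Icc 0 (π / 2)) :=
    strictMonoOn_of_deriv_pos (convex_Icc _ _) hf.continuous.continuousOn
      (by rwa [interior_Icc])
  have hpi : (0 : ℝ) ≤ π / 2 := by positivity
  have hright : π / 2 ∈ Set.Icc (0 : ℝ) (π / 2) := ⟨hpi, le_rfl⟩
  have hsub : Set.Ioo (finv ν) (π / 2) ⊆ Set.Ioo 0 (π / 2) :=
    Set.Ioo_subset_Ioo_left (hfinv ν hν).1.1
  have hfmem : ∀ x ∈ Set.Ioo (finv ν) (π / 2), f x ∈ Set.Ioo ν a := by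
    intro x hx
    have hx' := Set.Ioo_subset_Icc_self (hsub hx)
    constructor
    · have h := hmono (hfinv ν hν).1 hx' hx.1
      rwa [(hfinv ν hν).2] at h
    · rw [ha]
      exact hmono hx' hright hx.2
  have hleft : ∀ x ∈ Set.Ioo (finv ν) (π / 2), finv (f x) = x := by
    intro x hx
    have h := hfinv (f x) ⟨hν.1.trans (hfmem x hx).1, (hfmem x hx).2⟩
    exact hmono.injOn h.1 (Set.Ioo_subset_Icc_self (hsub hx)) h.2
  have himage : (fun x => halfPeriodSubstInv a ν (f x)) '' Set.Ioo (finv ν) (π / 2)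
      = Set.Ioi 0 := by
    apply Set.Subset.antisymm
    · rintro _ ⟨x, hx, rfl⟩
      exact halfPeriodSubstInv_pos hν.1 (hfmem x hx)
    · intro τ hτ
      have hw := halfPeriodSubst_mem_Ioo hν hτ
      have h := hfinv _ ⟨hν.1.trans hw.1, hw.2⟩
      refine ⟨finv (halfPeriodSubst a ν τ), ⟨?_, ?_⟩, ?_⟩
      · rw [← hmono.lt_iff_lt (hfinv ν hν).1 h.1, h.2, (hfinv ν hν).2]
        exact hw.1
      · rw [← hmono.lt_iff_lt h.1 hright, h.2, ← ha]
        exact hw.2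
      · simp only [h.2]
        exact halfPeriodSubstInv_subst hν hτ
  have hinj : Set.InjOn (fun x => halfPeriodSubstInv a ν (f x)) (Set.Ioo (finv ν) (π / 2)) := by
    intro x hx y hy hxy
    have h := congrArg (fun τ => finv (halfPeriodSubst a ν τ)) hxy
    simpa only [halfPeriodSubst_substInv hν.1 (hfmem x hx),
      halfPeriodSubst_substInv hν.1 (hfmem y hy), hleft x hx, hleft y hy] using h
  have hderiv : ∀ x ∈ Set.Ioo (finv ν) (π / 2), HasDerivWithinAt
      (fun x => halfPeriodSubstInv a ν (f x)) _ (Set.Ioo (finv ν) (π / 2)) x := fun x hx =>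
    ((hasDerivAt_halfPeriodSubstInv hν.1 (hfmem x hx)).comp x
      (hf.differentiable (by simp) x).hasDerivAt).hasDerivWithinAt
  rw [← himage, lintegral_image_eq_lintegral_abs_deriv_mul measurableSet_Ioo hderiv hinj]
  refine setLIntegral_congr_fun measurableSet_Ioo fun x hx => ?_
  have hsubst := halfPeriodSubst_substInv hν.1 (hfmem x hx)
  have hsq := sq_halfPeriodSubstInv hν.1 (hfmem x hx)
  have hd := hf' x (hsub hx)
  obtain ⟨h1, h2⟩ := hfmem x hx
  have hν0 := hν.1
  have hf0' : 0 < f x := hν0.trans h1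
  have h3 : 0 < f x ^ 2 - ν ^ 2 := by nlinarith
  have h4 : 0 < a ^ 2 - f x ^ 2 := by nlinarith
  have h5 : 0 < a ^ 2 - ν ^ 2 := by linarith
  have hS := Real.sqrt_pos.2 h3
  have hR := Real.sqrt_pos.2 h4
  have e1 : a ^ 2 * halfPeriodSubstInv a ν (f x) ^ 2 + 1
      = f x ^ 2 * (a ^ 2 - ν ^ 2) / (ν ^ 2 * (a ^ 2 - f x ^ 2)) := by
    rw [hsq]; field_simp; ring
  rw [halfPeriodSubst] at hsubst
  rw [hsubst, hleft x hx, hA, e1, ← ENNReal.ofReal_mul (abs_nonneg _), abs_of_pos (by positivity)]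
  congr 1
  field_simp
end

section
/- If the function −f''/f is monotonically increasing on (0,π/2), then the half period function φ_f is monotonically decreasing on (0,a); if −f''/f is monotonically decreasing on (0,π/2), then φ_f is monotonically increasing on (0,a). -/
open Real Set

open MeasureTheory

/-- The monotone form of l'Hôpital's rule at the right endpoint of an interval. -/
lemma monotoneOn_div_of_monotoneOn_deriv_div {p q p' q' : ℝ → ℝ} {l b : ℝ}
    (hpc : ContinuousOn p (Ioc l b)) (hqc : ContinuousOn q (Ioc l b))
    (hp : ∀ x ∈ Ioo l b, HasDerivAt p (p' x) x) (hq : ∀ x ∈ Ioo l b, HasDerivAt q (q' x) x)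
    (hq' : ∀ x ∈ Ioo l b, q' x < 0) (hpb : p b = 0) (hqb : q b = 0)
    (hmono : MonotoneOn (fun x => p' x / q' x) (Ioo l b)) :
    MonotoneOn (fun x => p x / q x) (Ioo l b) := by
  have slope : ∀ x y, l < x → x < y → y ≤ b →
      ∃ c ∈ Ioo x y, q y < q x ∧ p x - p y = p' c / q' c * (q x - q y) := by
    intro x y hx hxy hy
    have hIcc : Icc x y ⊆ Ioc l b := fun z hz => ⟨hx.trans_le hz.1, hz.2.trans hy⟩
    have hIoo : Ioo x y ⊆ Ioo l b := fun z hz => ⟨hx.trans hz.1, hz.2.trans_le hy⟩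
    obtain ⟨c, hc, h⟩ := exists_ratio_hasDerivAt_eq_ratio_slope p p' hxy (hpc.mono hIcc)
      (fun z hz => hp z (hIoo hz)) q q' (hqc.mono hIcc) (fun z hz => hq z (hIoo hz))
    obtain ⟨d, hd, h2⟩ := exists_hasDerivAt_eq_slope q q' hxy (hqc.mono hIcc)
      (fun z hz => hq z (hIoo hz))
    have hd0 := hq' d (hIoo hd)
    have hc0 := hq' c (hIoo hc)
    rw [h2, div_lt_iff₀ (sub_pos.2 hxy)] at hd0
    refine ⟨c, hc, by linarith, ?_⟩
    rw [div_mul_eq_mul_div, eq_div_iff hc0.ne]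
    linarith
  intro x hx y hy hxy
  rcases hxy.eq_or_lt with rfl | hxy
  · exact le_rfl
  obtain ⟨c, hc, hqy, hcy⟩ := slope y b hy.1 hy.2 le_rfl
  obtain ⟨d, hd, hqxy, hdx⟩ := slope x y hx.1 hxy hy.2.le
  rw [hpb, hqb, sub_zero, sub_zero] at hcy
  rw [hqb] at hqy
  have hdc : p' d / q' d ≤ p' c / q' c :=
    hmono ⟨hx.1.trans hd.1, hd.2.trans hy.2⟩ ⟨hy.1.trans hc.1, hc.2⟩ (hd.2.trans hc.1).le
  change p x / q x ≤ p y / q y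
  rw [hcy, mul_div_cancel_right₀ _ hqy.ne', div_le_iff₀ (hqy.trans hqxy)]
  nlinarith [mul_le_mul_of_nonneg_right hdc (sub_pos.2 hqxy).le]

/-- The reciprocal square root of a function with a simple zero is integrable next to it. -/
lemma integrableOn_inv_sqrt_of_simple_zero {h : ℝ → ℝ} {c b : ℝ} (hcb : c < b)
    (hcont : Continuous h) (hdiff : DifferentiableAt ℝ h c) (hc : h c = 0)
    (hderiv : 0 < deriv h c) (hpos : ∀ x ∈ Ioc c b, 0 < h x) :
    IntegrableOn (fun x => (√(h x))⁻¹) (Ioo c b) := by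
  have hds : ContinuousOn (dslope h c) (Icc c b) := by
    have := (continuousOn_dslope (f := h) (a := c) Filter.univ_mem).2 ⟨hcont.continuousOn, hdiff⟩
    exact this.mono (subset_univ _)
  obtain ⟨m, hm, hmin⟩ := isCompact_Icc.exists_isMinOn (nonempty_Icc.2 hcb.le) hds
  have hslope : ∀ x, h x = (x - c) * dslope h c x := fun x => by
    have := sub_smul_dslope h c x
    rw [hc, sub_zero, smul_eq_mul] at this
    exact this.symm
  have hm0 : 0 < dslope h c m := by
    rcases hm.1.eq_or_lt with rfl | hcm
    · rwa [dslope_same]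
    · have := hpos m ⟨hcm, hm.2⟩
      rw [hslope] at this
      exact pos_of_mul_pos_right this (sub_pos.2 hcm).le
  have hint : IntegrableOn (fun x => (√(dslope h c m))⁻¹ * (x - c) ^ (-(1 / 2) : ℝ)) (Ioo c b) := by
    have h1 : IntervalIntegrable (fun x : ℝ => x ^ (-(1 / 2) : ℝ)) volume 0 (b - c) :=
      intervalIntegral.intervalIntegrable_rpow' (by norm_num)
    have h2 := (h1.comp_sub_right c).const_mul (√(dslope h c m))⁻¹
    rw [zero_add, sub_add_cancel] at h2
    exact ((intervalIntegrable_iff_integrableOn_Ioc_of_le hcb.le).1 h2).mono_set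
      Ioo_subset_Ioc_self
  refine hint.mono' ?_ ?_
  · exact (hcont.measurable.sqrt.inv).aestronglyMeasurable
  · filter_upwards [ae_restrict_mem measurableSet_Ioo] with x hx
    have hxc : 0 < x - c := sub_pos.2 hx.1
    rw [norm_of_nonneg (by positivity), rpow_neg hxc.le, ← sqrt_eq_rpow, ← mul_inv,
      ← sqrt_mul hm0.le]
    have hle : dslope h c m ≤ dslope h c x := hmin ⟨hx.1.le, hx.2.le⟩
    refine inv_anti₀ (sqrt_pos.2 (mul_pos hm0 hxc)) (sqrt_le_sqrt ?_)
    rw [hslope, mul_comm]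
    exact mul_le_mul_of_nonneg_left hle hxc.le

/-- The height `v` at which `1 / v ^ 2` divides the interval from `1 / a ^ 2` to `1 / ν ^ 2` in the
ratio `s : 1 - s`. -/
noncomputable def harmonicHeight (a ν s : ℝ) : ℝ := (√((1 - s) / a ^ 2 + s / ν ^ 2))⁻¹

lemma harmonicHeight_mem_Ioo {a ν s : ℝ} (hν : 0 < ν) (ha : ν < a) (hs : s ∈ Ioo 0 1) :
    harmonicHeight a ν s ∈ Ioo ν a := by
  have ha0 : 0 < a := hν.trans ha
  have hlt : 1 / a ^ 2 < 1 / ν ^ 2 := by gcongr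
  have h1s : 0 < 1 - s := sub_pos.2 hs.2
  have hs0 := hs.1
  have e : (1 - s) / a ^ 2 + s / ν ^ 2 = (1 - s) * (1 / a ^ 2) + s * (1 / ν ^ 2) := by ring
  constructor
  · rw [harmonicHeight, lt_inv_comm₀ hν (sqrt_pos.2 (by positivity)), sqrt_lt' (by positivity), e,
      inv_pow, ← one_div]
    nlinarith
  · rw [harmonicHeight, inv_lt_comm₀ (sqrt_pos.2 (by positivity)) ha0, lt_sqrt (by positivity), e,
      inv_pow, ← one_div]
    nlinarith

lemma harmonicHeight_mono {a ν₁ ν₂ s : ℝ} (hν : 0 < ν₁) (hle : ν₁ ≤ ν₂) (ha : 0 < a)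
    (hs : s ∈ Ioo 0 1) : harmonicHeight a ν₁ s ≤ harmonicHeight a ν₂ s := by
  have h1s : 0 < 1 - s := sub_pos.2 hs.2
  have hs0 := hs.1
  have hν₂ := hν.trans_le hle
  unfold harmonicHeight
  gcongr

lemma inv_harmonicHeight_sq {a ν s : ℝ} (hs : s ∈ Ioo 0 1) :
    1 / harmonicHeight a ν s ^ 2 = (1 - s) / a ^ 2 + s / ν ^ 2 := by
  have h1s : 0 < 1 - s := sub_pos.2 hs.2
  have hs0 := hs.1
  rw [harmonicHeight, inv_pow, one_div, inv_inv, sq_sqrt (by positivity)]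

lemma period_integrand_eq {y y' a ν : ℝ} (hν : 0 < ν) (hy : ν < y) (ha : y < a) (hy' : 0 < y') :
    |-2 * y' / y ^ 3 / (1 / ν ^ 2 - 1 / a ^ 2)| *
      (√((a ^ 2 - y ^ 2) / y' ^ 2) /
        (a * √((1 / y ^ 2 - 1 / a ^ 2) / (1 / ν ^ 2 - 1 / a ^ 2) *
          (1 - (1 / y ^ 2 - 1 / a ^ 2) / (1 / ν ^ 2 - 1 / a ^ 2))))) =
      2 * (ν / (y * √(y ^ 2 - ν ^ 2))) := by
  have hy0 : 0 < y := hν.trans hy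
  have ha0 : 0 < a := hy0.trans ha
  have hD : 0 < 1 / ν ^ 2 - 1 / a ^ 2 := sub_pos.2 (by gcongr; exact hy.trans ha)
  have h1 : 0 < a ^ 2 - y ^ 2 := sub_pos.2 (by gcongr)
  have h2 : 0 < y ^ 2 - ν ^ 2 := sub_pos.2 (by gcongr)
  set D := 1 / ν ^ 2 - 1 / a ^ 2 with hDdef
  have e : (1 / y ^ 2 - 1 / a ^ 2) / D * (1 - (1 / y ^ 2 - 1 / a ^ 2) / D) =
      (a ^ 2 - y ^ 2) * (y ^ 2 - ν ^ 2) / (y ^ 2 * a * ν * D) ^ 2 := by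
    have : 1 - (1 / y ^ 2 - 1 / a ^ 2) / D = (1 / ν ^ 2 - 1 / y ^ 2) / D := by
      rw [eq_div_iff hD.ne', sub_mul, div_mul_cancel₀ _ hD.ne', hDdef]; ring
    rw [this]
    clear_value D
    field_simp
  rw [e, sqrt_div h1.le, sqrt_sq hy'.le, sqrt_div (by positivity), sqrt_sq (by positivity),
    sqrt_mul h1.le, abs_div, abs_of_pos hD, abs_div, abs_mul, abs_neg, abs_of_pos hy',
    abs_of_pos (by positivity : 0 < y ^ 3), abs_of_pos (by norm_num : (0 : ℝ) < 2)]
  have s1 := sqrt_pos.2 h1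
  have s2 := sqrt_pos.2 h2
  clear_value D
  field_simp

/-- In the parameter `s`, the half period is an integral over `(0, 1)` against the fixed weight
`1 / √(s * (1 - s))`. -/
lemma half_period_integral_eq {f finv : ℝ → ℝ} {a b ν : ℝ} (hfd : Differentiable ℝ f)
    (hb : 0 < b) (hf0 : f 0 = 0) (hfb : f b = a)
    (hf' : ∀ x ∈ Ioo 0 b, 0 < deriv f x)
    (hfinv : ∀ ν ∈ Ioo 0 a, finv ν ∈ Icc 0 b ∧ f (finv ν) = ν) (hν : ν ∈ Ioo 0 a) :
    IntegrableOn (fun s => √((a ^ 2 - f (finv (harmonicHeight a ν s)) ^ 2) /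
        deriv f (finv (harmonicHeight a ν s)) ^ 2) / (a * √(s * (1 - s)))) (Ioo 0 1) ∧
      ∫ s in Ioo 0 1, √((a ^ 2 - f (finv (harmonicHeight a ν s)) ^ 2) /
        deriv f (finv (harmonicHeight a ν s)) ^ 2) / (a * √(s * (1 - s))) =
      2 * ∫ x in (finv ν)..b, ν / (f x * √(f x ^ 2 - ν ^ 2)) := by
  have hmono : StrictMonoOn f (Icc 0 b) := by
    refine strictMonoOn_of_deriv_pos (convex_Icc 0 b) hfd.continuous.continuousOn ?_
    rwa [interior_Icc]
  obtain ⟨hν0, hνa⟩ := hν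
  have ha0 : 0 < a := hν0.trans hνa
  obtain ⟨hx, hfx⟩ := hfinv ν ⟨hν0, hνa⟩
  set c := finv ν
  have hc0 : 0 < c := hx.1.lt_of_ne (by rintro h; rw [← h, hf0] at hfx; exact hν0.ne hfx)
  have hcb : c < b := hx.2.lt_of_ne (by rintro h; rw [h, hfb] at hfx; exact hνa.ne' hfx)
  have hbmem : b ∈ Icc 0 b := ⟨hb.le, le_rfl⟩
  have hsub : ∀ x ∈ Ioo c b, x ∈ Icc 0 b := fun x h => ⟨(hc0.trans h.1).le, h.2.le⟩
  have hνf : ∀ x ∈ Ioo c b, ν < f x := fun x h => hfx ▸ hmono hx (hsub x h) h.1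
  have hfa : ∀ x ∈ Ioo c b, f x < a := fun x h => hfb ▸ hmono (hsub x h) hbmem h.2
  have hD : 0 < 1 / ν ^ 2 - 1 / a ^ 2 := sub_pos.2 (by gcongr)
  set D := 1 / ν ^ 2 - 1 / a ^ 2 with hDdef
  set σ : ℝ → ℝ := fun x => (1 / f x ^ 2 - 1 / a ^ 2) / D with hσ
  have hσd : ∀ x ∈ Ioo c b, HasDerivWithinAt σ (-2 * deriv f x / f x ^ 3 / D) (Ioo c b) x := by
    intro x h
    have hfx0 : f x ≠ 0 := (hν0.trans (hνf x h)).ne'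
    have h1 := ((((hfd x).hasDerivAt.pow 2).inv (pow_ne_zero 2 hfx0)).sub_const
      (1 / a ^ 2)).div_const D
    refine (h1.congr_deriv ?_).hasDerivWithinAt.congr_of_mem (fun y _ => ?_) h
    · simp only [Pi.pow_apply]
      push_cast
      field_simp
    · simp [hσ]
  have hinvσ : ∀ x ∈ Ioo c b, σ x ∈ Ioo 0 1 ∧ finv (harmonicHeight a ν (σ x)) = x := by
    intro x h
    have hν' := hνf x h
    have ha' := hfa x h
    have hfx0 : 0 < f x := hν0.trans hν'
    have hm : σ x ∈ Ioo 0 1 := by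
      constructor
      · refine div_pos (sub_pos.2 ?_) hD
        gcongr
      · rw [div_lt_one hD, hDdef]
        gcongr
    refine ⟨hm, ?_⟩
    have hh : harmonicHeight a ν (σ x) = f x := by
      have e : (1 - σ x) / a ^ 2 + σ x / ν ^ 2 = (f x ^ 2)⁻¹ := by
        have : (1 - σ x) / a ^ 2 + σ x / ν ^ 2 = 1 / a ^ 2 + σ x * D := by rw [hDdef]; ring
        rw [this, hσ]
        simp only
        rw [div_mul_cancel₀ _ hD.ne']
        ring
      rw [harmonicHeight, e, sqrt_inv, sqrt_sq hfx0.le, inv_inv]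
    rw [hh]
    obtain ⟨h1, h2⟩ := hfinv (f x) ⟨hfx0, ha'⟩
    exact hmono.injOn h1 (hsub x h) h2
  have hinj : InjOn σ (Ioo c b) := fun x hx y hy hxy => by
    rw [← (hinvσ x hx).2, hxy, (hinvσ y hy).2]
  have himg : σ '' Ioo c b = Ioo 0 1 := by
    ext s
    constructor
    · rintro ⟨x, h, rfl⟩
      exact (hinvσ x h).1
    · intro hs
      have hH := harmonicHeight_mem_Ioo hν0 hνa hs
      obtain ⟨h1, h2⟩ := hfinv (harmonicHeight a ν s) ⟨hν0.trans hH.1, hH.2⟩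
      refine ⟨finv (harmonicHeight a ν s), ⟨?_, ?_⟩, ?_⟩
      · refine (hmono.lt_iff_lt hx h1).1 ?_
        rw [hfx, h2]
        exact hH.1
      · refine (hmono.lt_iff_lt h1 hbmem).1 ?_
        rw [hfb, h2]
        exact hH.2
      · simp only [hσ]
        rw [h2, inv_harmonicHeight_sq hs, div_eq_iff hD.ne', hDdef]
        ring
  have hpull : EqOn (fun x => |-2 * deriv f x / f x ^ 3 / D| •
      (fun s => √((a ^ 2 - f (finv (harmonicHeight a ν s)) ^ 2) /
        deriv f (finv (harmonicHeight a ν s)) ^ 2) / (a * √(s * (1 - s)))) (σ x))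
      (fun x => 2 * (ν / (f x * √(f x ^ 2 - ν ^ 2)))) (Ioo c b) := by
    intro x h
    simp only [smul_eq_mul]
    rw [(hinvσ x h).2]
    exact period_integrand_eq hν0 (hνf x h) (hfa x h) (hf' x ⟨hc0.trans h.1, h.2⟩)
  have hint : IntegrableOn (fun x => 2 * (ν / (f x * √(f x ^ 2 - ν ^ 2)))) (Ioo c b) := by
    have hder : HasDerivAt (fun x => f x ^ 2 - ν ^ 2) (2 * ν * deriv f c) c := by
      refine (((hfd c).hasDerivAt.pow 2).sub_const (ν ^ 2)).congr_deriv ?_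
      rw [hfx]
      norm_num
    have h1 := integrableOn_inv_sqrt_of_simple_zero hcb (h := fun x => f x ^ 2 - ν ^ 2)
      ((hfd.continuous.pow 2).sub continuous_const) hder.differentiableAt
      (by simp [hfx])
      (by rw [hder.deriv]; have := hf' c ⟨hc0, hcb⟩; positivity)
      (fun x h => by
        have : ν < f x := hfx ▸ hmono hx ⟨(hc0.trans h.1).le, h.2⟩ h.1
        exact sub_pos.2 (by gcongr))
    refine Integrable.const_mul (h1.mono' ?_ ?_) 2
    · have := hfd.continuous.measurable
      exact Measurable.aestronglyMeasurable (by fun_prop)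
    · filter_upwards [ae_restrict_mem measurableSet_Ioo] with x h
      have hν' := hνf x h
      have hfx0 : 0 < f x := hν0.trans hν'
      rw [norm_of_nonneg (by positivity), ← div_div, div_eq_mul_inv]
      exact mul_le_of_le_one_left (by positivity) ((div_le_one hfx0).2 hν'.le)
  constructor
  · rw [← himg, integrableOn_image_iff_integrableOn_abs_deriv_smul measurableSet_Ioo hσd hinj]
    exact (integrableOn_congr_fun hpull measurableSet_Ioo).2 hint
  · rw [← himg, integral_image_eq_integral_abs_deriv_smul measurableSet_Ioo hσd hinj,
      setIntegral_congr_fun measurableSet_Ioo hpull, integral_const_mul,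
      intervalIntegral.integral_of_le hcb.le, integral_Ioc_eq_integral_Ioo]

/-- The half periods at `ν` and `μ` compare as the quotients `(a² - f²) / f'²` do at equal
parameters `s`. -/
lemma half_period_le_of_quotient_le {f finv : ℝ → ℝ} {a b ν μ : ℝ} (hfd : Differentiable ℝ f)
    (hb : 0 < b) (hf0 : f 0 = 0) (hfb : f b = a)
    (hf' : ∀ x ∈ Ioo 0 b, 0 < deriv f x)
    (hfinv : ∀ ν ∈ Ioo 0 a, finv ν ∈ Icc 0 b ∧ f (finv ν) = ν) (hν : ν ∈ Ioo 0 a)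
    (hμ : μ ∈ Ioo 0 a)
    (hle : ∀ s ∈ Ioo (0 : ℝ) 1, (a ^ 2 - f (finv (harmonicHeight a ν s)) ^ 2) /
        deriv f (finv (harmonicHeight a ν s)) ^ 2 ≤
      (a ^ 2 - f (finv (harmonicHeight a μ s)) ^ 2) /
        deriv f (finv (harmonicHeight a μ s)) ^ 2) :
    2 * ∫ x in (finv ν)..b, ν / (f x * √(f x ^ 2 - ν ^ 2)) ≤
      2 * ∫ x in (finv μ)..b, μ / (f x * √(f x ^ 2 - μ ^ 2)) := by
  obtain ⟨h1, h2⟩ := half_period_integral_eq hfd hb hf0 hfb hf' hfinv hν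
  obtain ⟨h3, h4⟩ := half_period_integral_eq hfd hb hf0 hfb hf' hfinv hμ
  rw [← h2, ← h4]
  refine setIntegral_mono_on h1 h3 measurableSet_Ioo fun s hs => ?_
  have ha0 : 0 < a := hν.1.trans hν.2
  have := hle s hs
  gcongr

/-- If `−f''/f` is monotonically increasing on `(0,π/2)`, then the half period function `φ_f`
is monotonically decreasing on `(0,a)`; if `−f''/f` is monotonically decreasing on
`(0,π/2)`, then `φ_f` is monotonically increasing on `(0,a)`. -/
theorem half_period_monotonicity_of_curvature_monotonicity
    (f : ℝ → ℝ) (a : ℝ)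
    (hf : ContDiff ℝ (⊤ : ℕ∞) f)
    (hf0 : f 0 = 0)
    (hfnonneg : ∀ x ∈ Set.Icc 0 (π / 2), 0 ≤ f x)
    (hf' : ∀ x ∈ Set.Ioo 0 (π / 2), 0 < deriv f x)
    (hf'pi : deriv f (π / 2) = 0)
    (ha : a = f (π / 2))
    (finv : ℝ → ℝ)
    (hfinv : ∀ ν ∈ Set.Ioo 0 a, finv ν ∈ Set.Icc 0 (π / 2) ∧ f (finv ν) = ν)
    (φ : ℝ → ℝ)
    (hφ : ∀ ν ∈ Set.Ioo 0 a,
      φ ν = 2 * ∫ x in (finv ν)..(π / 2), ν / (f x * Real.sqrt ((f x) ^ 2 - ν ^ 2))) :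
    (MonotoneOn (fun x => -(deriv (deriv f) x) / f x) (Set.Ioo 0 (π / 2)) →
      AntitoneOn φ (Set.Ioo 0 a)) ∧
    (AntitoneOn (fun x => -(deriv (deriv f) x) / f x) (Set.Ioo 0 (π / 2)) →
      MonotoneOn φ (Set.Ioo 0 a)) := by
  have hb : 0 < π / 2 := by positivity
  have hfd : Differentiable ℝ f := hf.differentiable (by simp)
  have hfd2 : Differentiable ℝ (deriv f) :=
    (hf.iterate_deriv 1).differentiable (by simp)
  have hmono : StrictMonoOn f (Icc 0 (π / 2)) := by
    refine strictMonoOn_of_deriv_pos (convex_Icc 0 _) hfd.continuous.continuousOn ?_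
    rwa [interior_Icc]
  have hpos : ∀ x ∈ Ioo 0 (π / 2), 0 < f x := fun x hx =>
    hf0 ▸ hmono ⟨le_rfl, hb.le⟩ ⟨hx.1.le, hx.2.le⟩ hx.1
  have hlt : ∀ x ∈ Ioo 0 (π / 2), f x < a := fun x hx =>
    ha ▸ hmono ⟨hx.1.le, hx.2.le⟩ ⟨hb.le, le_rfl⟩ hx.2
  have hgap : ∀ x ∈ Ioo 0 (π / 2), 0 < a ^ 2 - f x ^ 2 := fun x hx => by
    have h1 := hpos x hx
    have h2 := hlt x hx
    exact sub_pos.2 (by gcongr)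
  have hq : ∀ x, HasDerivAt (fun x => a ^ 2 - f x ^ 2) (-(2 * f x * deriv f x)) x := fun x => by
    refine (((hfd x).hasDerivAt.pow 2).const_sub (a ^ 2)).congr_deriv ?_
    norm_num
  have hp : ∀ x, HasDerivAt (fun x => deriv f x ^ 2) (2 * deriv f x * deriv (deriv f) x) x :=
    fun x => by
      refine ((hfd2 x).hasDerivAt.pow 2).congr_deriv ?_
      norm_num
  have hq' : ∀ x ∈ Ioo 0 (π / 2), -(2 * f x * deriv f x) < 0 := fun x hx => by
    have h1 := hpos x hx
    have h2 := hf' x hx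
    exact neg_neg_of_pos (by positivity)
  have hratio : ∀ x ∈ Ioo 0 (π / 2), 2 * deriv f x * deriv (deriv f) x / -(2 * f x * deriv f x) =
      -(deriv (deriv f) x) / f x := fun x hx => by
    have h1 := (hpos x hx).ne'
    have h2 := (hf' x hx).ne'
    field_simp
  have hsq : ContinuousOn (fun x => deriv f x ^ 2) (Ioc 0 (π / 2)) :=
    (hfd2.continuous.pow 2).continuousOn
  have hqc : ContinuousOn (fun x => a ^ 2 - f x ^ 2) (Ioc 0 (π / 2)) :=
    (continuous_const.sub (hfd.continuous.pow 2)).continuousOn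
  have hheight : ∀ ν₁ ∈ Ioo 0 a, ∀ ν₂ ∈ Ioo 0 a, ν₁ ≤ ν₂ → ∀ s ∈ Ioo (0 : ℝ) 1,
      finv (harmonicHeight a ν₁ s) ∈ Ioo 0 (π / 2) ∧
      finv (harmonicHeight a ν₂ s) ∈ Ioo 0 (π / 2) ∧
      finv (harmonicHeight a ν₁ s) ≤ finv (harmonicHeight a ν₂ s) := by
    have hmem : ∀ w ∈ Ioo 0 a, finv w ∈ Ioo 0 (π / 2) := by
      intro w hw
      obtain ⟨h1, h2⟩ := hfinv w hw
      refine ⟨h1.1.lt_of_ne fun h => ?_, h1.2.lt_of_ne fun h => ?_⟩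
      · rw [← h, hf0] at h2
        exact hw.1.ne h2
      · rw [h, ← ha] at h2
        exact hw.2.ne' h2
    intro ν₁ h₁ ν₂ h₂ hle s hs
    have m₁ := harmonicHeight_mem_Ioo h₁.1 h₁.2 hs
    have m₂ := harmonicHeight_mem_Ioo h₂.1 h₂.2 hs
    have m₁' : harmonicHeight a ν₁ s ∈ Ioo 0 a := ⟨h₁.1.trans m₁.1, m₁.2⟩
    have m₂' : harmonicHeight a ν₂ s ∈ Ioo 0 a := ⟨h₂.1.trans m₂.1, m₂.2⟩
    refine ⟨hmem _ m₁', hmem _ m₂', (hmono.le_iff_le (hfinv _ m₁').1 (hfinv _ m₂').1).1 ?_⟩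
    rw [(hfinv _ m₁').2, (hfinv _ m₂').2]
    exact harmonicHeight_mono h₁.1 hle (h₁.1.trans h₁.2) hs
  have hinv : ∀ x ∈ Ioo 0 (π / 2), ∀ y ∈ Ioo 0 (π / 2),
      deriv f x ^ 2 / (a ^ 2 - f x ^ 2) ≤ deriv f y ^ 2 / (a ^ 2 - f y ^ 2) →
      (a ^ 2 - f y ^ 2) / deriv f y ^ 2 ≤ (a ^ 2 - f x ^ 2) / deriv f x ^ 2 := by
    intro x hx y hy h
    rw [← inv_div (deriv f y ^ 2), ← inv_div (deriv f x ^ 2)]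
    exact inv_anti₀ (div_pos (pow_pos (hf' x hx) 2) (hgap x hx)) h
  constructor
  · intro hmon ν₁ h₁ ν₂ h₂ hle
    rw [hφ ν₁ h₁, hφ ν₂ h₂]
    refine half_period_le_of_quotient_le hfd hb hf0 ha.symm hf' hfinv h₂ h₁ fun s hs => ?_
    obtain ⟨hx, hy, hxy⟩ := hheight ν₁ h₁ ν₂ h₂ hle s hs
    refine hinv _ hx _ hy (monotoneOn_div_of_monotoneOn_deriv_div hsq hqc (fun x _ => hp x)
      (fun x _ => hq x) hq' (by simp [hf'pi]) (by simp [ha]) ?_ hx hy hxy)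
    exact hmon.congr fun x hx => (hratio x hx).symm
  · intro hanti ν₁ h₁ ν₂ h₂ hle
    rw [hφ ν₁ h₁, hφ ν₂ h₂]
    refine half_period_le_of_quotient_le hfd hb hf0 ha.symm hf' hfinv h₁ h₂ fun s hs => ?_
    obtain ⟨hx, hy, hxy⟩ := hheight ν₁ h₁ ν₂ h₂ hle s hs
    refine hinv _ hy _ hx ?_
    have := monotoneOn_div_of_monotoneOn_deriv_div hsq.neg hqc (fun x _ => (hp x).neg)
      (fun x _ => hq x) hq' (by simp [hf'pi]) (by simp [ha]) ?_ hx hy hxy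
    · simpa [neg_div] using this
    · refine hanti.neg.congr fun x hx => ?_
      change -(-(deriv (deriv f) x) / f x) = _
      rw [← hratio x hx, neg_div]
end

section
/- For every real number λ > 0, the half period function φ_λ := φ_{m_λ} associated to the restriction of m_λ to [0,π/2] is strictly decreasing on the interval (0, √(λ+1)). -/
open Real Set

/-- An antiderivative of the half period integrand of `m_λ`, for the lower end point `y`. -/
lemma hasDerivAt_half_period_primitive {lam x y : ℝ} (hlam : 0 < lam) (hy : 0 < y) (hyx : y < x)
    (hx : x < π / 2) :
    HasDerivAt
      (fun t => lam * sin y / (lam + 1) * arcsin (cos t / cos y)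
        - arcsin (sin y * cos t / (cos y * sin t)))
      (sin y * (1 + lam * cos x ^ 2) / ((lam + 1) * sin x * √(cos y ^ 2 - cos x ^ 2))) x := by
  have hsy : 0 < sin y := sin_pos_of_pos_of_lt_pi hy (by linarith)
  have hsx : 0 < sin x := sin_pos_of_pos_of_lt_pi (by linarith) (by linarith)
  have hcx : 0 < cos x := cos_pos_of_mem_Ioo ⟨by linarith, hx⟩
  have hcxy : cos x < cos y := cos_lt_cos_of_nonneg_of_le_pi hy.le (by linarith) hyx
  have hcy : 0 < cos y := hcx.trans hcxy
  have hsq : 0 < cos y ^ 2 - cos x ^ 2 := by nlinarith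
  have hD : 0 < √(cos y ^ 2 - cos x ^ 2) := sqrt_pos.2 hsq
  have hs : sin x ^ 2 = 1 - cos x ^ 2 := sin_sq x
  have hs' : sin y ^ 2 = 1 - cos y ^ 2 := sin_sq y
  have h1 : √(1 - (cos x / cos y) ^ 2) = √(cos y ^ 2 - cos x ^ 2) / cos y := by
    rw [← sqrt_sq hcy.le, ← sqrt_div' _ (sq_nonneg _), sqrt_sq hcy.le]
    congr 1
    field_simp
  have h2 : √(1 - (sin y * cos x / (cos y * sin x)) ^ 2)
      = √(cos y ^ 2 - cos x ^ 2) / (cos y * sin x) := by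
    have hp : 0 < cos y * sin x := by positivity
    rw [← sqrt_sq hp.le, ← sqrt_div' _ (sq_nonneg _), sqrt_sq hp.le]
    congr 1
    field_simp
    rw [hs, hs']
    ring
  have hlt1 : cos x / cos y < 1 := (div_lt_one hcy).2 hcxy
  have hlt2 : sin y * cos x / (cos y * sin x) < 1 := by
    rw [div_lt_one (by positivity)]
    have := sin_pos_of_pos_of_lt_pi (x := x - y) (by linarith) (by linarith)
    rw [sin_sub] at this
    linarith
  have hpos1 : 0 < cos x / cos y := by positivity
  have hpos2 : 0 < sin y * cos x / (cos y * sin x) := by positivity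
  have d1 := (hasDerivAt_arcsin (by linarith) hlt1.ne).comp x
    ((hasDerivAt_cos x).div_const (cos y))
  have d2 := (hasDerivAt_arcsin (by linarith) hlt2.ne).comp x
    (((hasDerivAt_cos x).const_mul (sin y)).div ((hasDerivAt_sin x).const_mul (cos y))
      (by positivity))
  refine ((d1.const_mul (lam * sin y / (lam + 1))).sub d2).congr_deriv ?_
  rw [h1, h2]
  field_simp
  linear_combination hs

/-- The half period integrand of `m_λ`, with `ν = m_λ(y)`, in factored form. -/
lemma half_period_integrand_eq {lam x y : ℝ} (hlam : 0 < lam) (hsy : 0 < sin y)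
    (hsx : 0 < sin x) (hsq : 0 < cos y ^ 2 - cos x ^ 2) :
    √(lam + 1) * sin y / √(1 + lam * cos y ^ 2) /
        (√(lam + 1) * sin x / √(1 + lam * cos x ^ 2) *
          √((√(lam + 1) * sin x / √(1 + lam * cos x ^ 2)) ^ 2
            - (√(lam + 1) * sin y / √(1 + lam * cos y ^ 2)) ^ 2))
      = sin y * (1 + lam * cos x ^ 2) / ((lam + 1) * sin x * √(cos y ^ 2 - cos x ^ 2)) := by
  have hB : 0 < lam + 1 := by linarith
  have hX : 0 < 1 + lam * cos x ^ 2 := by positivity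
  have hY : 0 < 1 + lam * cos y ^ 2 := by positivity
  have hD : 0 < √(cos y ^ 2 - cos x ^ 2) := sqrt_pos.2 hsq
  have key : √((√(lam + 1) * sin x / √(1 + lam * cos x ^ 2)) ^ 2
            - (√(lam + 1) * sin y / √(1 + lam * cos y ^ 2)) ^ 2)
      = (lam + 1) * √(cos y ^ 2 - cos x ^ 2)
        / (√(1 + lam * cos x ^ 2) * √(1 + lam * cos y ^ 2)) := by
    rw [sqrt_eq_iff_mul_self_eq_of_pos (by positivity)]
    simp only [div_pow, mul_pow, sq_sqrt hB.le, sq_sqrt hX.le, sq_sqrt hY.le, ← sq,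
      sq_sqrt hsq.le, sin_sq]
    field_simp
    ring
  rw [key]
  field_simp
  rw [sq_sqrt hX.le]

lemma half_period_integral_eq_s6 {lam y : ℝ} (hlam : 0 < lam) (hy : 0 < y) (hy2 : y < π / 2) :
    ∫ x in y..(π / 2), sin y * (1 + lam * cos x ^ 2) /
        ((lam + 1) * sin x * √(cos y ^ 2 - cos x ^ 2))
      = π / 2 * (1 - lam * sin y / (lam + 1)) := by
  have hsy : 0 < sin y := sin_pos_of_pos_of_lt_pi hy (by linarith)
  have hcy : 0 < cos y := cos_pos_of_mem_Ioo ⟨by linarith, hy2⟩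
  have hcont : ContinuousOn (fun t => lam * sin y / (lam + 1) * arcsin (cos t / cos y)
        - arcsin (sin y * cos t / (cos y * sin t))) (Icc y (π / 2)) := by
    refine ContinuousOn.sub (by fun_prop) (continuous_arcsin.comp_continuousOn ?_)
    refine ContinuousOn.div (by fun_prop) (by fun_prop) fun t ht => ?_
    have : 0 < sin t := sin_pos_of_pos_of_lt_pi (by linarith [ht.1]) (by linarith [ht.2])
    positivity
  have hderiv := fun x (hx : x ∈ Ioo y (π / 2)) =>
    hasDerivAt_half_period_primitive hlam hy hx.1 hx.2
  have hint := intervalIntegral.integrableOn_deriv_of_nonneg hcont hderiv fun x hx => by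
    have : 0 < sin x := sin_pos_of_pos_of_lt_pi (by linarith [hx.1]) (by linarith [hx.2])
    positivity
  rw [intervalIntegral.integral_eq_sub_of_hasDerivAt_of_le hy2.le hcont hderiv
    ((intervalIntegrable_iff_integrableOn_Ioc_of_le hy2.le).2 hint)]
  rw [cos_pi_div_two, div_self hcy.ne', mul_comm (sin y) (cos y), div_self (by positivity)]
  simp
  ring

/-- For every `λ > 0`, the half period function `φ_λ` associated to the restriction of
`m_λ(r) = √(λ+1)·sin r / √(1 + λ·cos² r)` to `[0,π/2]` is strictly decreasing on
`(0, √(λ+1))`. -/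
theorem half_period_of_m_lambda_strictAnti
    (lam : ℝ) (hlam : 0 < lam)
    (m : ℝ → ℝ)
    (hm : ∀ r, m r = Real.sqrt (lam + 1) * Real.sin r / Real.sqrt (1 + lam * Real.cos r ^ 2))
    (a : ℝ) (ha : a = Real.sqrt (lam + 1))
    (finv : ℝ → ℝ)
    (hfinv : ∀ ν ∈ Set.Ioo 0 a, finv ν ∈ Set.Icc 0 (π / 2) ∧ m (finv ν) = ν)
    (φ : ℝ → ℝ)
    (hφ : ∀ ν ∈ Set.Ioo 0 a,
      φ ν = 2 * ∫ x in (finv ν)..(π / 2), ν / (m x * Real.sqrt ((m x) ^ 2 - ν ^ 2))) :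
    StrictAntiOn φ (Set.Ioo 0 a) := by
  have hpos : ∀ ν ∈ Ioo 0 a, 0 < finv ν := fun ν hν => by
    refine (hfinv ν hν).1.1.lt_of_ne fun h => hν.1.ne ?_
    rw [← (hfinv ν hν).2, ← h, hm]
    simp
  have hlt : ∀ ν ∈ Ioo 0 a, finv ν < π / 2 := fun ν hν => by
    refine (hfinv ν hν).1.2.lt_of_ne fun h => hν.2.ne ?_
    rw [← (hfinv ν hν).2, h, hm, ha]
    simp
  have hval : ∀ ν ∈ Ioo 0 a, φ ν = π * (1 - lam * sin (finv ν) / (lam + 1)) := fun ν hν => by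
    have hy := hpos ν hν
    have hy2 := hlt ν hν
    have hmν := (hfinv ν hν).2
    rw [hφ ν hν]
    generalize finv ν = y at *
    have hcongr : ∫ x in y..(π / 2), ν / (m x * √((m x) ^ 2 - ν ^ 2))
        = ∫ x in y..(π / 2), sin y * (1 + lam * cos x ^ 2) /
          ((lam + 1) * sin x * √(cos y ^ 2 - cos x ^ 2)) := by
      refine intervalIntegral.integral_congr_ae (Filter.Eventually.of_forall fun x hx => ?_)
      rw [uIoc_of_le hy2.le] at hx
      have hcxy : cos x < cos y := cos_lt_cos_of_nonneg_of_le_pi hy.le (by linarith [hx.2]) hx.1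
      have hcx : 0 ≤ cos x := cos_nonneg_of_mem_Icc ⟨by linarith [hx.1], hx.2⟩
      rw [← hmν, hm, hm]
      exact half_period_integrand_eq hlam (sin_pos_of_pos_of_lt_pi hy (by linarith))
        (sin_pos_of_pos_of_lt_pi (by linarith [hx.1]) (by linarith [hx.2])) (by nlinarith)
    rw [hcongr, half_period_integral_eq_s6 hlam hy hy2]
    ring
  intro ν hν μ hμ hνμ
  rw [hval ν hν, hval μ hμ]
  have hsin : sin (finv ν) < sin (finv μ) := by
    by_contra! h
    refine hνμ.not_ge ?_
    rw [← (hfinv ν hν).2, ← (hfinv μ hμ).2, hm, hm]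
    have hs : 0 ≤ sin (finv μ) :=
      (sin_pos_of_pos_of_lt_pi (hpos μ hμ) (by linarith [hlt μ hμ, pi_pos])).le
    have hs' : 0 ≤ sin (finv ν) := hs.trans h
    have hsq : cos (finv ν) ^ 2 ≤ cos (finv μ) ^ 2 := by
      rw [cos_sq', cos_sq']
      gcongr
    gcongr
  gcongr
end

section
/- Let h : [0,π] → ℝ be a smooth function that extends to a smooth odd function on ℝ, with h'(x) > 0 on [0,π/2), h(π − x) = π − h(x) on [0,π], and h''(x) > 0 on (0,π/2) (respectively h''(x) ≥ 0 on (0,π/2)). Set a := 1/h'(0) and m(r) := a·sin(h(r)). Then the restriction of m to [0,π/2] is smooth with m(0) = 0, m'(x) > 0 on (0,π/2) and m'(π/2) = 0, and the half period function φ_m is strictly decreasing (respectively monotonically decreasing) on (0,a). -/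
open Real Set

lemma arcsin_cot_comp_hasDerivAt {h : ℝ → ℝ} {h' x a ν : ℝ} (hd : HasDerivAt h h' x)
    (hν : 0 < ν) (hνa : ν < a) (hs : 0 < sin (h x)) (hlt : ν < a * sin (h x)) :
    HasDerivAt (fun x => arcsin (ν / √(a ^ 2 - ν ^ 2) * (cos (h x) / sin (h x))))
      (-(h' * (ν / (sin (h x) * √((a * sin (h x)) ^ 2 - ν ^ 2))))) x := by
  have hA : 0 < a ^ 2 - ν ^ 2 := by nlinarith
  have hB : 0 < (a * sin (h x)) ^ 2 - ν ^ 2 := by nlinarith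
  have hcs := sin_sq_add_cos_sq (h x)
  have hw : 1 - (ν / √(a ^ 2 - ν ^ 2) * (cos (h x) / sin (h x))) ^ 2
      = ((a * sin (h x)) ^ 2 - ν ^ 2) / (sin (h x) ^ 2 * (a ^ 2 - ν ^ 2)) := by
    rw [mul_pow, div_pow, div_pow, sq_sqrt hA.le]
    field_simp
    linear_combination (-ν ^ 2) * hcs
  have hw1 : 0 < 1 - (ν / √(a ^ 2 - ν ^ 2) * (cos (h x) / sin (h x))) ^ 2 := by
    rw [hw]; positivity
  have hinner := ((hd.cos.div hd.sin hs.ne').const_mul (ν / √(a ^ 2 - ν ^ 2)))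
  have := (Real.hasDerivAt_arcsin (fun hw' => ?_) (fun hw' => ?_)).comp x hinner
  rotate_left
  iterate 2 (simp only [Pi.div_apply] at hw'; rw [hw'] at hw1; norm_num at hw1)
  refine this.congr_deriv ?_
  simp only [Pi.div_apply]
  rw [show -sin (h x) * h' * sin (h x) - cos (h x) * (cos (h x) * h') = -h' by
    linear_combination (-h') * hcs, hw, sqrt_div hB.le, sqrt_mul (by positivity), sqrt_sq hs.le]
  have h1 : √(a ^ 2 - ν ^ 2) ≠ 0 := (sqrt_pos.2 hA).ne'
  have h2 : √((a * sin (h x)) ^ 2 - ν ^ 2) ≠ 0 := (sqrt_pos.2 hB).ne'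
  field_simp

lemma half_period_integral_eq_s8 {h g : ℝ → ℝ} {a ν p : ℝ} (hdiff : Differentiable ℝ h)
    (hmono : StrictMonoOn h (Icc 0 (π / 2))) (h0 : h 0 = 0) (h1 : h (π / 2) = π / 2)
    (hpos : ∀ x ∈ Ico 0 (π / 2), 0 < deriv h x)
    (hg : ∀ y ∈ Icc 0 (π / 2), g y ∈ Icc 0 (π / 2) ∧ h (g y) = y)
    (hν : 0 < ν) (hνa : ν < a) (hp : p ∈ Icc 0 (π / 2)) (hpν : a * sin (h p) = ν) :
    ∫ x in p..(π / 2), ν / (a * sin (h x) * √((a * sin (h x)) ^ 2 - ν ^ 2))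
      = ∫ θ in 0..(π / 2),
        (a * deriv h (g (π / 2 - arctan (√(a ^ 2 - ν ^ 2) / ν * sin θ))))⁻¹ := by
  have hpi := pi_pos
  have ha : 0 < a := hν.trans hνa
  have hA : 0 < √(a ^ 2 - ν ^ 2) := sqrt_pos.2 (by nlinarith)
  have hE0 : (0 : ℝ) ∈ Icc 0 (π / 2) := ⟨le_rfl, by positivity⟩
  have hE1 : π / 2 ∈ Icc 0 (π / 2) := ⟨by positivity, le_rfl⟩
  have hlt : ∀ x ∈ Ioo p (π / 2), h p < h x ∧ 0 < h x ∧ h x < π / 2 := fun x hx => by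
    have hx' : x ∈ Icc 0 (π / 2) := ⟨hp.1.trans hx.1.le, hx.2.le⟩
    exact ⟨hmono hp hx' hx.1, h0 ▸ hmono hE0 hx' (hp.1.trans_lt hx.1), h1 ▸ hmono hx' hE1 hx.2⟩
  have hp0 : 0 ≤ h p := h0 ▸ hmono.monotoneOn hE0 hp hp.1
  have hs : ∀ x ∈ Ioo p (π / 2), 0 < sin (h x) := fun x hx =>
    sin_pos_of_pos_of_lt_pi (hlt x hx).2.1 (by linarith [(hlt x hx).2.2])
  have hνs : ∀ x ∈ Ioo p (π / 2), ν < a * sin (h x) := fun x hx => by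
    rw [← hpν]
    exact mul_lt_mul_of_pos_left
      (sin_lt_sin_of_lt_of_le_pi_div_two (by linarith) (hlt x hx).2.2.le (hlt x hx).1) ha
  set Θ : ℝ → ℝ := fun x => arcsin (ν / √(a ^ 2 - ν ^ 2) * (cos (h x) / sin (h x))) with hΘ
  have hsin : ∀ x ∈ Ioo p (π / 2), ν / √(a ^ 2 - ν ^ 2) * (cos (h x) / sin (h x)) ∈ Ioo 0 1 := by
    intro x hx
    have hS := hs x hx
    have hC : 0 < cos (h x) :=
      cos_pos_of_mem_Ioo ⟨by linarith [(hlt x hx).2.1], (hlt x hx).2.2⟩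
    refine ⟨by positivity, ?_⟩
    rw [div_mul_div_comm, div_lt_one (by positivity)]
    refine lt_of_pow_lt_pow_left₀ 2 (by positivity) ?_
    rw [mul_pow, mul_pow, sq_sqrt (by nlinarith), cos_sq']
    nlinarith [hνs x hx]
  have hleft : ∀ x ∈ Ioo p (π / 2),
      g (π / 2 - arctan (√(a ^ 2 - ν ^ 2) / ν * sin (Θ x))) = x := by
    intro x hx
    have hw := hsin x hx
    have hl := hlt x hx
    rw [hΘ]
    simp only
    rw [sin_arcsin (by linarith [hw.1]) hw.2.le]
    have : √(a ^ 2 - ν ^ 2) / ν * (ν / √(a ^ 2 - ν ^ 2) * (cos (h x) / sin (h x)))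
        = tan (π / 2 - h x) := by
      rw [tan_pi_div_two_sub, tan_eq_sin_div_cos, inv_div]
      field_simp
    rw [this, arctan_tan (by linarith) (by linarith), sub_sub_cancel]
    have hgx := hg (h x) ⟨hl.2.1.le, hl.2.2.le⟩
    exact hmono.injOn hgx.1 ⟨hp.1.trans hx.1.le, hx.2.le⟩ hgx.2
  have himage : Θ '' Ioo p (π / 2) = Ioo 0 (π / 2) := by
    apply Subset.antisymm
    · rintro _ ⟨x, hx, rfl⟩
      exact ⟨arcsin_pos.2 (hsin x hx).1, arcsin_lt_pi_div_two.2 (hsin x hx).2⟩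
    · intro θ hθ
      have hsθ : 0 < sin θ := sin_pos_of_pos_of_lt_pi hθ.1 (by linarith [hθ.2])
      have hsθ1 : sin θ < 1 := by
        rw [← sin_pi_div_two]
        exact sin_lt_sin_of_lt_of_le_pi_div_two (by linarith [hθ.1]) le_rfl hθ.2
      set t := arctan (√(a ^ 2 - ν ^ 2) / ν * sin θ) with ht
      have ht0 : 0 < t := arctan_pos.2 (by positivity)
      have ht1 : t < π / 2 := arctan_lt_pi_div_two _
      have hgt := hg (π / 2 - t) ⟨by linarith, by linarith⟩
      have hcot : cos (h (g (π / 2 - t))) / sin (h (g (π / 2 - t)))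
          = √(a ^ 2 - ν ^ 2) / ν * sin θ := by
        rw [hgt.2, cos_pi_div_two_sub, sin_pi_div_two_sub, ← tan_eq_sin_div_cos, tan_arctan]
      refine ⟨g (π / 2 - t), ⟨?_, ?_⟩, ?_⟩
      · refine (hmono.lt_iff_lt hp hgt.1).1 ?_
        rw [hgt.2]
        by_contra! hcon
        have hp2 : h p ≤ π / 2 := h1 ▸ hmono.monotoneOn hp hE1 hp.2
        have hsp : cos t ≤ ν / a := by
          rw [← sin_pi_div_two_sub, le_div_iff₀ ha, ← hpν, mul_comm]
          exact mul_le_mul_of_nonneg_left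
            (sin_le_sin_of_le_of_le_pi_div_two (by linarith) hp2 hcon) ha.le
        have hct : 0 < cos t := cos_pos_of_mem_Ioo ⟨by linarith, ht1⟩
        have htan : tan t = √(a ^ 2 - ν ^ 2) / ν * sin θ := tan_arctan _
        have h3 : 1 / cos t ^ 2 = 1 + tan t ^ 2 := by
          rw [tan_eq_sin_div_cos]; field_simp; linarith [sin_sq_add_cos_sq t]
        rw [htan, mul_pow, div_pow, sq_sqrt (by nlinarith)] at h3
        have h4 : cos t ^ 2 ≤ (ν / a) ^ 2 := pow_le_pow_left₀ hct.le hsp 2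
        have h5 : a ^ 2 / ν ^ 2 ≤ 1 / cos t ^ 2 := by
          rw [← one_div_div, ← div_pow]
          exact one_div_le_one_div_of_le (by positivity) h4
        have h6 : (a ^ 2 - ν ^ 2) / ν ^ 2 * sin θ ^ 2 < (a ^ 2 - ν ^ 2) / ν ^ 2 := by
          refine mul_lt_of_lt_one_right (div_pos (by nlinarith) (by positivity)) ?_
          nlinarith
        have h7 : (a ^ 2 - ν ^ 2) / ν ^ 2 = a ^ 2 / ν ^ 2 - 1 := by field_simp
        linarith
      · refine (hmono.lt_iff_lt hgt.1 hE1).1 ?_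
        rw [hgt.2, h1]; linarith
      · rw [hΘ]
        simp only
        rw [hcot, ← arcsin_sin (by linarith [hθ.1]) hθ.2.le]
        congr 1
        rw [arcsin_sin (by linarith [hθ.1]) hθ.2.le]
        field_simp
  have hinj : InjOn Θ (Ioo p (π / 2)) := fun x hx y hy hxy => by
    rw [← hleft x hx, ← hleft y hy, hxy]
  have hcov := MeasureTheory.integral_image_eq_integral_abs_deriv_smul measurableSet_Ioo
    (fun x hx => (arcsin_cot_comp_hasDerivAt (hdiff x).hasDerivAt hν hνa (hs x hx)
      (hνs x hx)).hasDerivWithinAt) hinj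
    (fun θ => (a * deriv h (g (π / 2 - arctan (√(a ^ 2 - ν ^ 2) / ν * sin θ))))⁻¹)
  rw [intervalIntegral.integral_of_le hp.2, intervalIntegral.integral_of_le (by positivity),
    MeasureTheory.integral_Ioc_eq_integral_Ioo, MeasureTheory.integral_Ioc_eq_integral_Ioo,
    ← himage, hcov]
  refine MeasureTheory.setIntegral_congr_fun measurableSet_Ioo fun x hx => ?_
  have hd := hpos x ⟨hp.1.trans hx.1.le, hx.2⟩
  have hS := hs x hx
  have hB : 0 < √((a * sin (h x)) ^ 2 - ν ^ 2) := sqrt_pos.2 (by nlinarith [hνs x hx])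
  simp only [smul_eq_mul]
  rw [show arcsin (ν / √(a ^ 2 - ν ^ 2) * (cos (h x) / sin (h x))) = Θ x from rfl,
    hleft x hx, abs_neg, abs_of_pos (by positivity)]
  field_simp

lemma half_period_param_lt {a ν μ : ℝ} (hν : 0 < ν) (hlt : ν < μ) (hμ : μ < a) :
    √(a ^ 2 - μ ^ 2) / μ < √(a ^ 2 - ν ^ 2) / ν :=
  div_lt_div₀ (sqrt_lt_sqrt (by nlinarith) (by nlinarith)) hlt.le (sqrt_nonneg _) hν

lemma inverse_comp_param_intervalIntegrable {k g : ℝ → ℝ} {a U : ℝ} (ha : 0 < a) (hU : 0 ≤ U)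
    (hk : MonotoneOn k (Icc 0 (π / 2))) (hk0 : 0 < k 0)
    (hgm : MapsTo g (Icc 0 (π / 2)) (Icc 0 (π / 2))) (hg : MonotoneOn g (Icc 0 (π / 2))) :
    IntervalIntegrable (fun θ => (a * k (g (π / 2 - arctan (U * sin θ))))⁻¹)
      MeasureTheory.volume 0 (π / 2) := by
  have hpi := pi_pos
  apply MonotoneOn.intervalIntegrable
  rw [uIcc_of_le (by positivity)]
  have hmem : ∀ θ ∈ Icc 0 (π / 2), π / 2 - arctan (U * sin θ) ∈ Icc 0 (π / 2) := fun θ hθ =>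
    ⟨by linarith [arctan_lt_pi_div_two (U * sin θ)], sub_le_self _ (arctan_nonneg.2
      (mul_nonneg hU (sin_nonneg_of_nonneg_of_le_pi hθ.1 (by linarith [hθ.2]))))⟩
  intro x hx y hy hxy
  have hpos : 0 < k (g (π / 2 - arctan (U * sin y))) :=
    hk0.trans_le (hk ⟨le_rfl, by positivity⟩ (hgm (hmem y hy)) (hgm (hmem y hy)).1)
  have hsin : sin x ≤ sin y := sin_le_sin_of_le_of_le_pi_div_two (by linarith [hx.1]) hy.2 hxy
  refine inv_anti₀ (by positivity) (mul_le_mul_of_nonneg_left (hk (hgm (hmem y hy))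
    (hgm (hmem x hx)) (hg (hmem y hy) (hmem x hx) (sub_le_sub_left ?_ _))) ha.le)
  exact arctan_mono (mul_le_mul_of_nonneg_left hsin hU)

/-- Let `h : [0,π] → ℝ` be (the restriction of) a smooth odd function on `ℝ` with
`h' > 0` on `[0,π/2)` and `h(π − x) = π − h(x)` on `[0,π]`.  Set `a := 1/h'(0)` and
`m(r) := a·sin(h(r))`.  Then the restriction of `m` to `[0,π/2]` is smooth with
`m 0 = 0`, `m' > 0` on `(0,π/2)`, `m'(π/2) = 0`; moreover, if `h'' > 0` on `(0,π/2)`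
then the half period function `φ_m` is strictly decreasing on `(0,a)`, and if
`h'' ≥ 0` on `(0,π/2)` then `φ_m` is monotonically decreasing on `(0,a)`. -/
theorem half_period_decreasing_of_h_convex
    (h : ℝ → ℝ)
    (hsmooth : ContDiff ℝ (⊤ : ℕ∞) h)
    (hodd : ∀ x, h (-x) = -h x)
    (hpos : ∀ x ∈ Set.Ico 0 (π / 2), 0 < deriv h x)
    (hsym : ∀ x ∈ Set.Icc 0 π, h (π - x) = π - h x)
    (a : ℝ) (ha : a = 1 / deriv h 0)
    (m : ℝ → ℝ) (hm : ∀ r, m r = a * Real.sin (h r))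
    (finv : ℝ → ℝ)
    (hfinv : ∀ ν ∈ Set.Ioo 0 a, finv ν ∈ Set.Icc 0 (π / 2) ∧ m (finv ν) = ν)
    (φ : ℝ → ℝ)
    (hφ : ∀ ν ∈ Set.Ioo 0 a,
      φ ν = 2 * ∫ x in (finv ν)..(π / 2), ν / (m x * Real.sqrt ((m x) ^ 2 - ν ^ 2))) :
    (ContDiffOn ℝ (⊤ : ℕ∞) m (Set.Icc 0 (π / 2)) ∧ m 0 = 0 ∧
      (∀ x ∈ Set.Ioo 0 (π / 2), 0 < deriv m x) ∧ deriv m (π / 2) = 0) ∧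
    ((∀ x ∈ Set.Ioo 0 (π / 2), 0 < deriv (deriv h) x) → StrictAntiOn φ (Set.Ioo 0 a)) ∧
    ((∀ x ∈ Set.Ioo 0 (π / 2), 0 ≤ deriv (deriv h) x) → AntitoneOn φ (Set.Ioo 0 a)) := by
  have hpi := pi_pos
  have hE0 : (0 : ℝ) ∈ Icc 0 (π / 2) := ⟨le_rfl, by positivity⟩
  have hE1 : π / 2 ∈ Icc 0 (π / 2) := ⟨by positivity, le_rfl⟩
  have hdiff : Differentiable ℝ h := hsmooth.differentiable (by simp)
  have hdiff' : Differentiable ℝ (deriv h) :=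
    (contDiff_infty.1 hsmooth 2).differentiable_deriv_two
  have h0 : h 0 = 0 := by
    have := hodd 0
    rw [neg_zero] at this
    linarith
  have h1 : h (π / 2) = π / 2 := by
    have := hsym (π / 2) ⟨by positivity, by linarith⟩
    rw [sub_half] at this
    linarith
  have hmono : StrictMonoOn h (Icc 0 (π / 2)) := by
    refine strictMonoOn_of_deriv_pos (convex_Icc _ _) hdiff.continuous.continuousOn fun x hx => ?_
    rw [interior_Icc] at hx
    exact hpos x ⟨hx.1.le, hx.2⟩
  have hd0 : 0 < deriv h 0 := hpos 0 ⟨le_rfl, by positivity⟩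
  have ha0 : 0 < a := ha ▸ one_div_pos.2 hd0
  obtain rfl : m = fun r => a * sin (h r) := funext hm
  have hmd (x : ℝ) : deriv (fun r => a * sin (h r)) x = a * (cos (h x) * deriv h x) :=
    ((hdiff x).hasDerivAt.sin.const_mul a).deriv
  have hsurj : SurjOn h (Icc 0 (π / 2)) (Icc 0 (π / 2)) := by
    have := intermediate_value_Icc (by positivity : (0 : ℝ) ≤ π / 2) hdiff.continuous.continuousOn
    rwa [h0, h1] at this
  obtain ⟨g, hg⟩ : ∃ g : ℝ → ℝ, ∀ y ∈ Icc 0 (π / 2), g y ∈ Icc 0 (π / 2) ∧ h (g y) = y := by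
    choose! g hg using hsurj
    exact ⟨g, fun y hy => hg hy⟩
  have hgm : MapsTo g (Icc 0 (π / 2)) (Icc 0 (π / 2)) := fun y hy => (hg y hy).1
  have hgmono : StrictMonoOn g (Icc 0 (π / 2)) := fun x hx y hy hxy => by
    rw [← hmono.lt_iff_lt (hgm hx) (hgm hy), (hg x hx).2, (hg y hy).2]
    exact hxy
  have hφ' : ∀ ν ∈ Ioo 0 a, φ ν = 2 * ∫ θ in 0..(π / 2),
      (a * deriv h (g (π / 2 - arctan (√(a ^ 2 - ν ^ 2) / ν * sin θ))))⁻¹ := fun ν hν => by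
    rw [hφ ν hν, half_period_integral_eq_s8 hdiff hmono h0 h1 hpos hg hν.1 hν.2 (hfinv ν hν).1
      (hfinv ν hν).2]
  have hint (hk : MonotoneOn (deriv h) (Icc 0 (π / 2))) : ∀ ν ∈ Ioo 0 a, IntervalIntegrable
      (fun θ => (a * deriv h (g (π / 2 - arctan (√(a ^ 2 - ν ^ 2) / ν * sin θ))))⁻¹)
      MeasureTheory.volume 0 (π / 2) := fun ν hν =>
    inverse_comp_param_intervalIntegrable ha0 (div_nonneg (sqrt_nonneg _) hν.1.le) hk hd0 hgm
      hgmono.monotoneOn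
  have hmem : ∀ ν ∈ Ioo 0 a, ∀ θ ∈ Icc 0 (π / 2),
      π / 2 - arctan (√(a ^ 2 - ν ^ 2) / ν * sin θ) ∈ Icc 0 (π / 2) := fun ν hν θ hθ =>
    ⟨by linarith [arctan_lt_pi_div_two (√(a ^ 2 - ν ^ 2) / ν * sin θ)],
      sub_le_self _ (arctan_nonneg.2 (mul_nonneg (div_nonneg (sqrt_nonneg _) hν.1.le)
        (sin_nonneg_of_nonneg_of_le_pi hθ.1 (by linarith [hθ.2]))))⟩
  have hgpos (hk : MonotoneOn (deriv h) (Icc 0 (π / 2))) :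
      ∀ y ∈ Icc 0 (π / 2), 0 < deriv h (g y) := fun y hy =>
    hd0.trans_le (hk hE0 (hgm hy) (hgm hy).1)
  refine ⟨⟨?_, by simp [h0], fun x hx => ?_, by rw [hmd, h1, cos_pi_div_two]; ring⟩,
    fun hconv => ?_, fun hconv => ?_⟩
  · exact (contDiff_const.mul hsmooth.sin).contDiffOn
  · have hx' := Ioo_subset_Icc_self hx
    have hlo : 0 < h x := h0 ▸ hmono hE0 hx' hx.1
    have hhi : h x < π / 2 := h1 ▸ hmono hx' hE1 hx.2
    have hcos : 0 < cos (h x) := cos_pos_of_mem_Ioo ⟨by linarith, hhi⟩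
    have hd := hpos x ⟨hx.1.le, hx.2⟩
    rw [hmd]
    positivity
  · have hk : StrictMonoOn (deriv h) (Icc 0 (π / 2)) :=
      strictMonoOn_of_deriv_pos (convex_Icc _ _) hdiff'.continuous.continuousOn
        (by rwa [interior_Icc])
    intro ν hν μ hμ hlt
    rw [hφ' ν hν, hφ' μ hμ]
    refine mul_lt_mul_of_pos_left ?_ two_pos
    rw [← sub_pos, ← intervalIntegral.integral_sub (hint hk.monotoneOn ν hν)
      (hint hk.monotoneOn μ hμ)]
    refine intervalIntegral.intervalIntegral_pos_of_pos_on
      ((hint hk.monotoneOn ν hν).sub (hint hk.monotoneOn μ hμ)) (fun θ hθ => ?_) (by positivity)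
    have hθ' := Ioo_subset_Icc_self hθ
    have hθs : 0 < sin θ := sin_pos_of_pos_of_lt_pi hθ.1 (by linarith [hθ.2])
    have hA := hmem ν hν θ hθ'
    have hB := hmem μ hμ θ hθ'
    rw [sub_pos]
    exact inv_strictAnti₀ (mul_pos ha0 (hgpos hk.monotoneOn _ hA)) (mul_lt_mul_of_pos_left
      (hk (hgm hA) (hgm hB) (hgmono hA hB (sub_lt_sub_left (arctan_strictMono
        (mul_lt_mul_of_pos_right (half_period_param_lt hν.1 hlt hμ.2) hθs)) _))) ha0)
  · have hk : MonotoneOn (deriv h) (Icc 0 (π / 2)) :=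
      monotoneOn_of_deriv_nonneg (convex_Icc _ _) hdiff'.continuous.continuousOn
        hdiff'.differentiableOn (by rwa [interior_Icc])
    intro ν hν μ hμ hle
    obtain rfl | hlt := hle.eq_or_lt
    · exact le_rfl
    rw [hφ' ν hν, hφ' μ hμ]
    refine mul_le_mul_of_nonneg_left ?_ zero_le_two
    refine intervalIntegral.integral_mono_on (by positivity) (hint hk μ hμ) (hint hk ν hν)
      fun θ hθ => ?_
    have hθs : 0 ≤ sin θ := sin_nonneg_of_nonneg_of_le_pi hθ.1 (by linarith [hθ.2])
    have hA := hmem ν hν θ hθ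
    have hB := hmem μ hμ θ hθ
    exact inv_anti₀ (mul_pos ha0 (hgpos hk _ hA)) (mul_le_mul_of_nonneg_left
      (hk (hgm hA) (hgm hB) (hgmono.monotoneOn hA hB (sub_le_sub_left (arctan_mono
        (mul_le_mul_of_nonneg_right (half_period_param_lt hν.1 hlt hμ.2).le hθs)) _))) ha0.le)
end

section
/- Suppose B is not identically zero on (0,π/2). Then for every positive integer N there exists n₀ such that for every integer n > n₀: h_n^B(x) ∈ (0,π) for all x ∈ (0,π/2), and there exist points 0 < x₁ < x₂ < ⋯ < x_N < π/2 such that G̃_n'(x_i)·G̃_n'(x_{i+1}) < 0 for all i = 1,…,N−1, where G̃_n(x) := h_n^B{}'(x)² − (cos(h_n^B(x))/sin(h_n^B(x)))·h_n^B{}''(x). Consequently, the number of points on (0,π/2) at which G̃_n attains a local maximum or local minimum tends to infinity as n → ∞. -/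
open Real Set

/-- A continuous function whose derivative changes from positive to negative has an interior
local maximum. -/
theorem exists_isLocalMax_of_deriv_pos_neg {f : ℝ → ℝ} {a b : ℝ} (hab : a < b)
    (hf : ContinuousOn f (Icc a b)) (ha : 0 < deriv f a) (hb : deriv f b < 0) :
    ∃ c ∈ Ioo a b, IsLocalMax f c := by
  obtain ⟨c, hc, hmax⟩ := isCompact_Icc.exists_isMaxOn (nonempty_Icc.2 hab.le) hf
  have key : ∀ d, (∃ᶠ y in nhds d, y ∈ Icc a b ∧ f d < f y) → c ≠ d := by
    rintro d hd rfl
    obtain ⟨y, hy, hlt⟩ := hd.exists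
    exact absurd (hmax hy) (not_le.2 hlt)
  have hca : c ≠ a := by
    apply key
    have hd := (differentiableAt_of_deriv_ne_zero ha.ne').hasDerivAt
    have h1 := (hasDerivAt_iff_tendsto_slope.1 hd).eventually (lt_mem_nhds ha)
    have h2 : ∀ᶠ y in nhdsWithin a (Ioi a), 0 < slope f a y :=
      h1.filter_mono (nhdsWithin_mono a fun y hy => ne_of_gt hy)
    have h3 : ∀ᶠ y in nhdsWithin a (Ioi a), y ∈ Icc a b ∧ f a < f y := by
      filter_upwards [h2, Ioc_mem_nhdsGT hab] with y hy hyab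
      refine ⟨⟨hyab.1.le, hyab.2⟩, ?_⟩
      rw [slope_def_field, div_pos_iff_of_pos_right (sub_pos.2 hyab.1)] at hy
      linarith
    exact h3.frequently.filter_mono nhdsWithin_le_nhds
  have hcb : c ≠ b := by
    apply key
    have hd := (differentiableAt_of_deriv_ne_zero hb.ne).hasDerivAt
    have h1 := (hasDerivAt_iff_tendsto_slope.1 hd).eventually (gt_mem_nhds hb)
    have h2 : ∀ᶠ y in nhdsWithin b (Iio b), slope f b y < 0 :=
      h1.filter_mono (nhdsWithin_mono b fun y hy => ne_of_lt hy)
    have h3 : ∀ᶠ y in nhdsWithin b (Iio b), y ∈ Icc a b ∧ f b < f y := by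
      filter_upwards [h2, Ico_mem_nhdsLT hab] with y hy hyab
      refine ⟨⟨hyab.1, hyab.2.le⟩, ?_⟩
      rw [slope_def_field] at hy
      by_contra hle
      have : 0 ≤ (f y - f b) / (y - b) :=
        div_nonneg_of_nonpos (by linarith) (by linarith [hyab.2])
      linarith
    exact h3.frequently.filter_mono nhdsWithin_le_nhds
  have hc' : c ∈ Ioo a b := ⟨lt_of_le_of_ne hc.1 hca.symm, lt_of_le_of_ne hc.2 hcb⟩
  exact ⟨c, hc', hmax.isLocalMax (Icc_mem_nhds hc'.1 hc'.2)⟩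

/-- A continuous function whose derivative has opposite signs at the endpoints has an interior
local extremum. -/
theorem exists_isLocalMax_or_isLocalMin_of_deriv_mul_neg {f : ℝ → ℝ} {a b : ℝ} (hab : a < b)
    (hf : ContinuousOn f (Icc a b)) (h : deriv f a * deriv f b < 0) :
    ∃ c ∈ Ioo a b, IsLocalMax f c ∨ IsLocalMin f c := by
  rcases mul_neg_iff.1 h with ⟨ha, hb⟩ | ⟨ha, hb⟩
  · obtain ⟨c, hc, hm⟩ := exists_isLocalMax_of_deriv_pos_neg hab hf ha hb
    exact ⟨c, hc, Or.inl hm⟩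
  · obtain ⟨c, hc, hm⟩ := exists_isLocalMax_of_deriv_pos_neg (f := fun x => -f x) hab hf.neg
      (by simpa using ha) (by simpa using hb)
    exact ⟨c, hc, Or.inr (by simpa using hm.neg)⟩

/-- A function whose derivative alternates in sign along `N + 1` points has at least `N` local
extrema. -/
theorem exists_finset_isLocalMax_or_isLocalMin {f : ℝ → ℝ} {u v : ℝ} {N : ℕ}
    (hf : ContinuousOn f (Ioo u v)) (x : Fin (N + 1) → ℝ) (hx : StrictMono x)
    (hxm : ∀ i, x i ∈ Ioo u v)
    (halt : ∀ i : ℕ, ∀ hi : i + 1 < N + 1,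
      deriv f (x ⟨i, Nat.lt_of_succ_lt hi⟩) * deriv f (x ⟨i + 1, hi⟩) < 0) :
    ∃ S : Finset ℝ, N ≤ S.card ∧ ∀ y ∈ S, y ∈ Ioo u v ∧ (IsLocalMax f y ∨ IsLocalMin f y) := by
  have hsub : ∀ i j, Icc (x i) (x j) ⊆ Ioo u v := fun i j =>
    Icc_subset_Ioo (hxm i).1 (hxm j).2
  have hex : ∀ i : Fin N, ∃ c ∈ Ioo (x i.castSucc) (x i.succ),
      IsLocalMax f c ∨ IsLocalMin f c := fun i =>
    exists_isLocalMax_or_isLocalMin_of_deriv_mul_neg (hx i.castSucc_lt_succ)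
      (hf.mono (hsub _ _)) (halt i (by omega))
  choose y hy hloc using hex
  have hmono : StrictMono y := fun i j hij =>
    (hy i).2.trans_le ((hx.monotone (Fin.succ_le_castSucc_iff.2 hij)).trans (hy j).1.le)
  refine ⟨Finset.univ.map ⟨y, hmono.injective⟩, by simp, fun z hz => ?_⟩
  obtain ⟨i, -, rfl⟩ := Finset.mem_map.1 hz
  exact ⟨hsub _ _ (Ioo_subset_Icc_self (hy i)), hloc i⟩

/-- A smooth function has three successive derivatives. -/
theorem exists_hasDerivAt_three {B : ℝ → ℝ} (hB : ContDiff ℝ (⊤ : ℕ∞) B) :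
    ∃ B₁ B₂ B₃ : ℝ → ℝ, (∀ x, HasDerivAt B (B₁ x) x) ∧ (∀ x, HasDerivAt B₁ (B₂ x) x) ∧
      (∀ x, HasDerivAt B₂ (B₃ x) x) := by
  have h1 : ContDiff ℝ (⊤ : ℕ∞) (deriv B) := (contDiff_infty_iff_deriv.1 hB).2
  have h2 : ContDiff ℝ (⊤ : ℕ∞) (deriv (deriv B)) := (contDiff_infty_iff_deriv.1 h1).2
  exact ⟨_, _, _, fun x => ((contDiff_infty_iff_deriv.1 hB).1 x).hasDerivAt,
    fun x => ((contDiff_infty_iff_deriv.1 h1).1 x).hasDerivAt,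
    fun x => ((contDiff_infty_iff_deriv.1 h2).1 x).hasDerivAt⟩

section Profile

variable {B B₁ B₂ B₃ : ℝ → ℝ} {α e k : ℝ}

theorem hasDerivAt_profile (h₁ : ∀ x, HasDerivAt B (B₁ x) x) (x : ℝ) :
    HasDerivAt (fun x => x - α * sin (2 * x) + e * (B x * sin (k * x)))
      (1 - 2 * α * cos (2 * x) + e * (B₁ x * sin (k * x) + k * B x * cos (k * x))) x := by
  have h2 := ((hasDerivAt_id x).const_mul 2).sin.const_mul α
  have hk := (h₁ x).mul ((hasDerivAt_id x).const_mul k).sin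
  refine HasDerivAt.congr_deriv (((hasDerivAt_id x).sub h2).add (hk.const_mul e)) ?_
  simp only [id]; ring

theorem hasDerivAt_profile_deriv (h₁ : ∀ x, HasDerivAt B (B₁ x) x)
    (h₂ : ∀ x, HasDerivAt B₁ (B₂ x) x) (x : ℝ) :
    HasDerivAt
      (fun x => 1 - 2 * α * cos (2 * x) + e * (B₁ x * sin (k * x) + k * B x * cos (k * x)))
      (4 * α * sin (2 * x) + e * (B₂ x * sin (k * x) + 2 * k * B₁ x * cos (k * x)
        - k ^ 2 * B x * sin (k * x))) x := by
  have h2 := ((hasDerivAt_id x).const_mul 2).cos.const_mul (2 * α)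
  have hs := (h₂ x).mul ((hasDerivAt_id x).const_mul k).sin
  have hc := ((h₁ x).const_mul k).mul ((hasDerivAt_id x).const_mul k).cos
  refine HasDerivAt.congr_deriv ((h2.const_sub 1).add ((hs.add hc).const_mul e)) ?_
  simp only [id]; ring

theorem hasDerivAt_profile_deriv_deriv (h₁ : ∀ x, HasDerivAt B (B₁ x) x)
    (h₂ : ∀ x, HasDerivAt B₁ (B₂ x) x) (h₃ : ∀ x, HasDerivAt B₂ (B₃ x) x) (x : ℝ) :
    HasDerivAt
      (fun x => 4 * α * sin (2 * x) + e * (B₂ x * sin (k * x) + 2 * k * B₁ x * cos (k * x)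
        - k ^ 2 * B x * sin (k * x)))
      (8 * α * cos (2 * x) + e * (B₃ x * sin (k * x) + 3 * k * B₂ x * cos (k * x)
        - 3 * k ^ 2 * B₁ x * sin (k * x) - k ^ 3 * B x * cos (k * x))) x := by
  have h2 := ((hasDerivAt_id x).const_mul 2).sin.const_mul (4 * α)
  have hs := (h₃ x).mul ((hasDerivAt_id x).const_mul k).sin
  have hc := ((h₂ x).const_mul (2 * k)).mul ((hasDerivAt_id x).const_mul k).cos
  have hs' := ((h₁ x).const_mul (k ^ 2)).mul ((hasDerivAt_id x).const_mul k).sin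
  refine HasDerivAt.congr_deriv (h2.add (((hs.add hc).sub hs').const_mul e)) ?_
  simp only [id]; ring

end Profile

/-- The derivative of the curvature expression `h'² - cot h · h''`. -/
theorem hasDerivAt_curvature {h h₁ h₂ : ℝ → ℝ} {d x : ℝ} (hd₀ : HasDerivAt h (h₁ x) x)
    (hd₁ : HasDerivAt h₁ (h₂ x) x) (hd₂ : HasDerivAt h₂ d x) (hs : sin (h x) ≠ 0) :
    HasDerivAt (fun x => h₁ x ^ 2 - cos (h x) / sin (h x) * h₂ x)
      (2 * h₁ x * h₂ x + h₁ x * h₂ x / sin (h x) ^ 2 - cos (h x) / sin (h x) * d) x := by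
  refine HasDerivAt.congr_deriv ((hd₁.pow 2).sub ((hd₀.cos.div hd₀.sin hs).mul hd₂)) ?_
  have hc := sin_sq_add_cos_sq (h x)
  simp only [Pi.div_apply]
  field_simp
  linear_combination (h₁ x * h₂ x) * hc

/-- The part of the derivative of the curvature that stays bounded, evaluated at the points where
`sin (k x) = 0`, with `t` standing for `e k cos (k x)`. -/
noncomputable def curvatureDerivRemainder (B B₁ B₂ : ℝ → ℝ) (α x t : ℝ) : ℝ :=
  2 * (1 - 2 * α * cos (2 * x) + t * B x) * (4 * α * sin (2 * x) + 2 * t * B₁ x)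
    + (1 - 2 * α * cos (2 * x) + t * B x) * (4 * α * sin (2 * x) + 2 * t * B₁ x)
      / sin (x - α * sin (2 * x)) ^ 2
    - cos (x - α * sin (2 * x)) / sin (x - α * sin (2 * x))
      * (8 * α * cos (2 * x) + 3 * t * B₂ x)

/-- The unperturbed profile `x - α sin 2x` maps `(0, π/2)` to itself, with a linear lower bound. -/
theorem unperturbed_bounds {α x : ℝ} (hα : α ∈ Ioo (0 : ℝ) (1 / 2)) (hx : x ∈ Ioo 0 (π / 2)) :
    (1 - 2 * α) * x ≤ x - α * sin (2 * x) ∧ x - α * sin (2 * x) < π / 2 := by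
  have h1 : sin (2 * x) ≤ 2 * x := sin_le (by linarith [hx.1])
  have h2 : 0 < sin (2 * x) := sin_pos_of_pos_of_lt_pi (by linarith [hx.1]) (by linarith [hx.2])
  constructor
  · nlinarith [mul_le_mul_of_nonneg_left h1 hα.1.le]
  · nlinarith [mul_pos hα.1 h2, hx.2]

theorem eventually_profile_mem_Ioo {B : ℝ → ℝ} (hB : Continuous B) {α : ℝ}
    (hα : α ∈ Ioo (0 : ℝ) (1 / 2)) :
    ∀ᶠ n : ℕ in Filter.atTop, ∀ x ∈ Ioo 0 (π / 2),
      x - α * sin (2 * x) + B x * sin (2 * (n : ℝ) ^ 2 * x) / (n : ℝ) ^ 5 ∈ Ioo 0 π := by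
  obtain ⟨C, hC⟩ := isCompact_Icc.exists_bound_of_continuousOn (s := Icc 0 (π / 2)) hB.continuousOn
  have hC0 : 0 ≤ C := (norm_nonneg _).trans (hC 0 ⟨le_rfl, by positivity⟩)
  have hpos : 0 < 1 - 2 * α := by linarith [hα.2]
  filter_upwards [tendsto_natCast_atTop_atTop.eventually_gt_atTop (2 * C / (1 - 2 * α)),
    tendsto_natCast_atTop_atTop.eventually_gt_atTop C,
    tendsto_natCast_atTop_atTop.eventually_ge_atTop (1 : ℝ)] with n hn1 hn2 hn3 x hx
  have hn0 : (0 : ℝ) < n := by linarith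
  obtain ⟨hlo, hhi⟩ := unperturbed_bounds hα hx
  have hBx : |B x| ≤ C := hC x ⟨hx.1.le, hx.2.le⟩
  have hp1 : |B x * sin (2 * (n : ℝ) ^ 2 * x) / (n : ℝ) ^ 5| < (1 - 2 * α) * x := by
    have hs : |sin (2 * (n : ℝ) ^ 2 * x)| ≤ 2 * (n : ℝ) ^ 2 * x := by
      have := abs_sin_le_abs (x := 2 * (n : ℝ) ^ 2 * x)
      rwa [abs_of_nonneg (a := 2 * (n : ℝ) ^ 2 * x) (by have := hx.1; positivity)] at this
    rw [abs_div, abs_mul, abs_of_pos (pow_pos hn0 5), div_lt_iff₀ (pow_pos hn0 5)]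
    have h1 : |B x| * |sin (2 * (n : ℝ) ^ 2 * x)| ≤ C * (2 * (n : ℝ) ^ 2 * x) :=
      mul_le_mul hBx hs (abs_nonneg _) hC0
    rw [div_lt_iff₀ hpos] at hn1
    have h2 : (n : ℝ) ^ 1 ≤ n ^ 3 := pow_le_pow_right₀ hn3 (by norm_num)
    have h3 : 2 * C < n ^ 3 * (1 - 2 * α) := by nlinarith
    have h4 : 0 < (n : ℝ) ^ 2 * x := mul_pos (by positivity) hx.1
    nlinarith [mul_lt_mul_of_pos_right h3 h4]
  have hp2 : |B x * sin (2 * (n : ℝ) ^ 2 * x) / (n : ℝ) ^ 5| < 1 := by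
    rw [abs_div, abs_mul, abs_of_pos (pow_pos hn0 5), div_lt_iff₀ (pow_pos hn0 5)]
    have h1 : |B x| * |sin (2 * (n : ℝ) ^ 2 * x)| ≤ C * 1 :=
      mul_le_mul hBx (abs_sin_le_one _) (abs_nonneg _) hC0
    have h2 : (n : ℝ) ^ 1 ≤ n ^ 5 := pow_le_pow_right₀ hn3 (by norm_num)
    linarith
  constructor
  · linarith [neg_abs_le (B x * sin (2 * (n : ℝ) ^ 2 * x) / (n : ℝ) ^ 5)]
  · linarith [le_abs_self (B x * sin (2 * (n : ℝ) ^ 2 * x) / (n : ℝ) ^ 5), pi_gt_three]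

/-- Every interval of length greater than `N π / k` contains `N` consecutive multiples of
`π / k`. -/
theorem exists_consecutive_multiples {a b k : ℝ} (hk : 0 < k) (N : ℕ)
    (hN : N * π / k < b - a) :
    ∃ j : ℤ, ∀ i : ℕ, i < N → (j + i) * π / k ∈ Icc a b := by
  refine ⟨⌈a * k / π⌉, fun i hi => ?_⟩
  have h1 := Int.le_ceil (a * k / π)
  have h2 := Int.ceil_lt_add_one (a * k / π)
  have hi' : (i : ℝ) + 1 ≤ N := by exact_mod_cast hi
  have hi0 : (0 : ℝ) ≤ i := i.cast_nonneg
  have hπ := pi_pos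
  rw [div_le_iff₀ hπ] at h1
  rw [← sub_lt_iff_lt_add, lt_div_iff₀ hπ] at h2
  rw [div_lt_iff₀ hk] at hN
  constructor
  · rw [le_div_iff₀ hk]
    nlinarith
  · rw [div_le_iff₀ hk]
    nlinarith

/-- At the points where `2n²x` is a multiple of `π`, the derivative of the curvature eventually has
the sign of `B(x₀) cos(2n²x)`, uniformly on a compact set on which `B` has the sign of `B(x₀)`. -/
theorem eventually_curvature_deriv_sign {B B₁ B₂ : ℝ → ℝ} (hB : Continuous B)
    (hB₁ : Continuous B₁) (hB₂ : Continuous B₂) {α β : ℝ} (hα : α ∈ Ioo (0 : ℝ) (1 / 2))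
    {K : Set ℝ} (hK : IsCompact K) (hKsub : K ⊆ Ioo 0 (π / 2)) (hβ : ∀ x ∈ K, 0 < B x * β) :
    ∀ᶠ n : ℕ in Filter.atTop, ∀ x ∈ K, ∀ c : ℝ, c ^ 2 = 1 →
      0 < (curvatureDerivRemainder B B₁ B₂ α x (2 / (n : ℝ) ^ 3 * c)
        + 8 * n * c * B x * (cos (x - α * sin (2 * x)) / sin (x - α * sin (2 * x)))) * (c * β) := by
  have hg : ∀ x ∈ K, 0 < sin (x - α * sin (2 * x)) ∧ 0 < cos (x - α * sin (2 * x)) := by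
    intro x hx
    obtain ⟨h1, h2⟩ := unperturbed_bounds hα (hKsub hx)
    have h3 : 0 < (1 - 2 * α) * x := mul_pos (by linarith [hα.2]) (hKsub hx).1
    exact ⟨sin_pos_of_pos_of_lt_pi (by linarith) (by linarith [pi_pos]),
      cos_pos_of_mem_Ioo ⟨by linarith [pi_pos], h2⟩⟩
  have hcont : ContinuousOn (fun p : ℝ × ℝ => curvatureDerivRemainder B B₁ B₂ α p.1 p.2)
      (K ×ˢ Icc (-2) 2) := by
    have hne : ∀ p ∈ K ×ˢ Icc (-2 : ℝ) 2, sin (p.1 - α * sin (2 * p.1)) ≠ 0 := fun p hp =>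
      (hg p.1 hp.1).1.ne'
    have hne2 : ∀ p ∈ K ×ˢ Icc (-2 : ℝ) 2, sin (p.1 - α * sin (2 * p.1)) ^ 2 ≠ 0 := fun p hp =>
      pow_ne_zero 2 (hne p hp)
    unfold curvatureDerivRemainder
    refine ContinuousOn.sub (ContinuousOn.add ?_ (ContinuousOn.div ?_ ?_ hne2))
      (ContinuousOn.mul (ContinuousOn.div ?_ ?_ hne) ?_) <;> fun_prop
  obtain ⟨M, hM⟩ := (hK.prod isCompact_Icc).exists_bound_of_continuousOn hcont
  obtain ⟨m, hm0, hm⟩ : ∃ m > 0, ∀ x ∈ K,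
      m ≤ B x * β * (cos (x - α * sin (2 * x)) / sin (x - α * sin (2 * x))) := by
    rcases K.eq_empty_or_nonempty with rfl | hne
    · exact ⟨1, one_pos, by simp⟩
    · have hc : ContinuousOn
          (fun x => B x * β * (cos (x - α * sin (2 * x)) / sin (x - α * sin (2 * x)))) K := by
        refine ContinuousOn.mul ?_ (ContinuousOn.div ?_ ?_ fun x hx => (hg x hx).1.ne') <;> fun_prop
      obtain ⟨y, hy, hmin⟩ := hK.exists_isMinOn hne hc
      exact ⟨_, mul_pos (hβ y hy) (div_pos (hg y hy).2 (hg y hy).1), fun x hx => hmin hx⟩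
  filter_upwards [tendsto_natCast_atTop_atTop.eventually_gt_atTop (M * |β| / (8 * m)),
    tendsto_natCast_atTop_atTop.eventually_ge_atTop (1 : ℝ)] with n hn1 hn2 x hx c hc
  have hc1 : |c| = 1 := by rw [← sq_eq_sq₀ (abs_nonneg c) zero_le_one, sq_abs, hc, one_pow]
  have ht : 2 / (n : ℝ) ^ 3 * c ∈ Icc (-2 : ℝ) 2 := by
    rw [mem_Icc, ← abs_le, abs_mul, hc1, mul_one, abs_of_nonneg (by positivity)]
    exact div_le_self zero_le_two (one_le_pow₀ hn2)
  have hF := hM (x, _) ⟨hx, ht⟩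
  set F := curvatureDerivRemainder B B₁ B₂ α x (2 / (n : ℝ) ^ 3 * c)
  have hFb : |F * (c * β)| ≤ M * |β| := by
    rw [abs_mul, abs_mul, hc1, one_mul]
    exact mul_le_mul_of_nonneg_right hF (abs_nonneg β)
  rw [div_lt_iff₀ (by positivity)] at hn1
  have hmx := mul_le_mul_of_nonneg_left (hm x hx) (by positivity : (0 : ℝ) ≤ 8 * n)
  have hsplit : (F + 8 * n * c * B x * (cos (x - α * sin (2 * x)) / sin (x - α * sin (2 * x))))
      * (c * β) = F * (c * β)
        + 8 * n * (B x * β * (cos (x - α * sin (2 * x)) / sin (x - α * sin (2 * x)))) := by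
    linear_combination
      8 * n * B x * β * (cos (x - α * sin (2 * x)) / sin (x - α * sin (2 * x))) * hc
  rw [hsplit]
  linarith [neg_abs_le (F * (c * β))]

/-- Let `B : [0,π] → ℝ` be the restriction of a smooth even function on `ℝ` with
`B(π − x) = B(x)` on `[0,π]`, `B(0) = B(π/2) = 0`, and suppose `B` is not identically
zero on `(0,π/2)`.  Let `α ∈ (0,1/2)` and `h_n^B(x) := x − α·sin(2x) + B(x)·sin(2n²x)/n⁵`,
and let `G̃_n(x) := h_n^B{}'(x)² − (cos(h_n^B(x))/sin(h_n^B(x)))·h_n^B{}''(x)` denote the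
Gaussian curvature function.  Then for every `N` there is `n₀` such that for all `n > n₀`:
`h_n^B` maps `(0,π/2)` into `(0,π)`, there are points `0 < x₁ < ⋯ < x_N < π/2` with
`G̃_n'(x_i)·G̃_n'(x_{i+1}) < 0` for `i = 1,…,N−1`; consequently `G̃_n` has at least `N`
local maxima or minima in `(0,π/2)`, so their number tends to infinity as `n → ∞`. -/
theorem curvature_oscillation_general
    (B : ℝ → ℝ)
    (hB : ContDiff ℝ (⊤ : ℕ∞) B)
    (heven : ∀ x, B (-x) = B x)
    (hsym : ∀ x ∈ Set.Icc 0 π, B (π - x) = B x)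
    (hB0 : B 0 = 0)
    (hBpi2 : B (π / 2) = 0)
    (hBne : ∃ x ∈ Set.Ioo 0 (π / 2), B x ≠ 0)
    (α : ℝ) (hα : α ∈ Set.Ioo (0 : ℝ) (1 / 2))
    (h : ℕ → ℝ → ℝ)
    (hh : ∀ n x, h n x =
      x - α * Real.sin (2 * x) + B x * Real.sin (2 * (n : ℝ) ^ 2 * x) / (n : ℝ) ^ 5)
    (G : ℕ → ℝ → ℝ)
    (hG : ∀ n x, G n x =
      (deriv (h n) x) ^ 2 -
        (Real.cos (h n x) / Real.sin (h n x)) * deriv (deriv (h n)) x) :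
    ∀ N : ℕ, ∃ n₀ : ℕ, ∀ n : ℕ, n₀ < n →
      (∀ x ∈ Set.Ioo 0 (π / 2), h n x ∈ Set.Ioo 0 π) ∧
      (∃ x : Fin N → ℝ, StrictMono x ∧ (∀ i, x i ∈ Set.Ioo 0 (π / 2)) ∧
        ∀ i : ℕ, ∀ hi : i + 1 < N,
          deriv (G n) (x ⟨i, Nat.lt_of_succ_lt hi⟩) * deriv (G n) (x ⟨i + 1, hi⟩) < 0) ∧
      (∃ S : Finset ℝ, N ≤ S.card ∧ ∀ x ∈ S, x ∈ Set.Ioo 0 (π / 2) ∧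
        (IsLocalMax (G n) x ∨ IsLocalMin (G n) x)) := by
  obtain ⟨B₁, B₂, B₃, h₁, h₂, h₃⟩ := exists_hasDerivAt_three hB
  have hBc : Continuous B := hB.continuous
  have hB₁c : Continuous B₁ := continuous_iff_continuousAt.2 fun x => (h₂ x).continuousAt
  have hB₂c : Continuous B₂ := continuous_iff_continuousAt.2 fun x => (h₃ x).continuousAt
  obtain ⟨x₀, hx₀, hne⟩ := hBne
  obtain ⟨r, hr, hball⟩ : ∃ r > 0, Metric.closedBall x₀ r ⊆
      Ioo 0 (π / 2) ∩ {x | 0 < B x * B x₀} := by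
    refine Metric.nhds_basis_closedBall.mem_iff.1 (Filter.inter_mem (Ioo_mem_nhds hx₀.1 hx₀.2) ?_)
    exact (isOpen_lt continuous_const (by fun_prop)).mem_nhds (mul_self_pos.2 hne)
  rw [Real.closedBall_eq_Icc] at hball
  have hsign := eventually_curvature_deriv_sign hBc hB₁c hB₂c hα isCompact_Icc
    (fun x hx => (hball hx).1) (fun x hx => (hball hx).2)
  -- closed forms for the derivatives of the profile and of the curvature
  have hfun : ∀ n, h n = fun x =>
      x - α * sin (2 * x) + ((n : ℝ) ^ 5)⁻¹ * (B x * sin (2 * (n : ℝ) ^ 2 * x)) := by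
    intro n; ext x; rw [hh]; ring
  have hd₀ : ∀ n x, HasDerivAt (h n) _ x := fun n x =>
    hfun n ▸ hasDerivAt_profile (α := α) (e := ((n : ℝ) ^ 5)⁻¹) (k := 2 * (n : ℝ) ^ 2) h₁ x
  have hderiv : ∀ n, deriv (h n) = _ := fun n => funext fun x => (hd₀ n x).deriv
  have hd₁ : ∀ n x, HasDerivAt (deriv (h n)) _ x := fun n x =>
    hderiv n ▸ hasDerivAt_profile_deriv (α := α) (e := ((n : ℝ) ^ 5)⁻¹) (k := 2 * (n : ℝ) ^ 2)
      h₁ h₂ x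
  have hderiv₂ : ∀ n, deriv (deriv (h n)) = _ := fun n => funext fun x => (hd₁ n x).deriv
  have hd₂ : ∀ n x, HasDerivAt (deriv (deriv (h n))) _ x := fun n x =>
    hderiv₂ n ▸ hasDerivAt_profile_deriv_deriv (α := α) (e := ((n : ℝ) ^ 5)⁻¹)
      (k := 2 * (n : ℝ) ^ 2) h₁ h₂ h₃ x
  have hGd : ∀ n x, sin (h n x) ≠ 0 → HasDerivAt (G n) _ x := fun n x hs => by
    have := hasDerivAt_curvature (hd₀ n x).differentiableAt.hasDerivAt
      (hd₁ n x).differentiableAt.hasDerivAt (hd₂ n x) hs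
    rwa [← funext (hG n)] at this
  have hmem := eventually_profile_mem_Ioo hBc hα
  -- the alternating points
  have hpts : ∀ N : ℕ, ∀ᶠ n : ℕ in Filter.atTop,
      ∃ x : Fin N → ℝ, StrictMono x ∧ (∀ i, x i ∈ Set.Ioo 0 (π / 2)) ∧
        ∀ i : ℕ, ∀ hi : i + 1 < N,
          deriv (G n) (x ⟨i, Nat.lt_of_succ_lt hi⟩) * deriv (G n) (x ⟨i + 1, hi⟩) < 0 := by
    intro N
    filter_upwards [hsign, hmem, tendsto_natCast_atTop_atTop.eventually_ge_atTop (1 : ℝ),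
      tendsto_natCast_atTop_atTop.eventually_gt_atTop (N * π / r)] with n hs hm hn1 hnN
    have hn0 : (0 : ℝ) < n := by linarith
    have hk : (0 : ℝ) < 2 * (n : ℝ) ^ 2 := by positivity
    obtain ⟨j, hj⟩ := exists_consecutive_multiples (a := x₀ - r) (b := x₀ + r) hk N (by
      rw [div_lt_iff₀ hr] at hnN
      rw [div_lt_iff₀ hk]
      nlinarith [mul_pos hr hn0, mul_le_mul_of_nonneg_left hn1 (mul_pos hr hn0).le])
    have hval : ∀ i : ℕ, i < N → 0 < deriv (G n) ((j + i) * π / (2 * (n : ℝ) ^ 2))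
        * (cos ((j + i) * π) * B x₀) := by
      intro i hi
      set x := ((j : ℝ) + i) * π / (2 * (n : ℝ) ^ 2) with hx
      have hkx : 2 * (n : ℝ) ^ 2 * x = (j + i) * π := by rw [hx]; field_simp
      have hsin : sin ((j + i) * π) = 0 := by exact_mod_cast sin_int_mul_pi (j + i)
      have hcos : cos ((j + i) * π) ^ 2 = 1 := by
        have := sin_sq_add_cos_sq (((j : ℝ) + i) * π)
        rw [hsin] at this; linarith
      have hpos := hs x (hj i hi) _ hcos
      have hx0 := (hball (hj i hi)).1
      have hhx : h n x = x - α * sin (2 * x) := by rw [hh, hkx, hsin]; ring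
      have hsh : sin (h n x) ≠ 0 := by
        have := hm x hx0
        rw [← hh] at this
        exact (sin_pos_of_mem_Ioo this).ne'
      rw [(hGd n x hsh).deriv]
      convert hpos using 2
      rw [(hd₁ n x).deriv, (hd₀ n x).deriv, hkx, hsin, hhx, curvatureDerivRemainder]
      generalize cos ((j + i) * π) = c
      have ht : ((n : ℝ) ^ 5)⁻¹ * (2 * (n : ℝ) ^ 2) = 2 / (n : ℝ) ^ 3 := by field_simp
      have ht' : ((n : ℝ) ^ 5)⁻¹ * (2 * (n : ℝ) ^ 2) ^ 3 = 8 * n := by field_simp; norm_num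
      rw [← ht, ← ht']
      ring
    refine ⟨fun i => (j + (i : ℕ)) * π / (2 * (n : ℝ) ^ 2), fun i i' hii => ?_,
      fun i => (hball (hj i i.2)).1, fun i hi => ?_⟩
    · have : ((i : ℕ) : ℝ) < (i' : ℕ) := by exact_mod_cast hii
      have hπ := pi_pos
      dsimp only
      gcongr
    · have e1 := hval i (by omega)
      have e2 := hval (i + 1) hi
      have hc : cos (((j : ℝ) + (i + 1 : ℕ)) * π) = -cos ((j + i) * π) := by
        rw [← cos_add_pi]; push_cast; ring_nf
      rw [hc] at e2
      have := mul_pos e1 e2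
      by_contra hcon
      dsimp only at hcon
      nlinarith [mul_nonneg (not_lt.1 hcon) (sq_nonneg (cos ((j + i) * π) * B x₀))]
  intro N
  obtain ⟨n₀, hn₀⟩ := Filter.eventually_atTop.1 ((hmem.and (hpts N)).and (hpts (N + 1)))
  refine ⟨n₀, fun n hn => ?_⟩
  obtain ⟨⟨hm, hx⟩, x, hx1, hx2, hx3⟩ := hn₀ n hn.le
  have hm' : ∀ x ∈ Set.Ioo 0 (π / 2), h n x ∈ Set.Ioo 0 π := fun x hx => hh n x ▸ hm x hx
  refine ⟨hm', hx, exists_finset_isLocalMax_or_isLocalMin (fun y hy => ?_) x hx1 hx2 hx3⟩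
  exact (hGd n y (sin_pos_of_mem_Ioo (hm' y hy)).ne').continuousAt.continuousWithinAt
end

section
/- For each integer n ≥ 2, let h_n(x) := x − sin(2x)/3 + sin²(2x)·sin(2n²x)/n⁵. Then for every positive integer N there exists n₀ such that for every integer n > n₀: h_n(x) ∈ (0,π) for all x ∈ (0,π/2), and there exist points 0 < x₁ < x₂ < ⋯ < x_N < π/2 such that G̃_n'(x_i)·G̃_n'(x_{i+1}) < 0 for all i = 1,…,N−1, where G̃_n(x) := h_n'(x)² − (cos(h_n(x))/sin(h_n(x)))·h_n''(x). Consequently, the number of points on each meridian of the 2-sphere of revolution M_n which attain a local maximum or local minimum of the Gaussian curvature along the meridian tends to infinity as n → ∞. -/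
open Real Set

/-- The profile `x - sin (2x) / 3 + sin² (2x) sin (c x) / A`. -/
noncomputable def oscProfile (c A x : ℝ) : ℝ :=
  x - sin (2 * x) / 3 + sin (2 * x) ^ 2 * sin (c * x) / A

/-- The first derivative of `oscProfile c A`. -/
noncomputable def oscProfile₁ (c A x : ℝ) : ℝ :=
  1 - 2 * cos (2 * x) / 3 +
    (4 * sin (2 * x) * cos (2 * x) * sin (c * x) + sin (2 * x) ^ 2 * (c * cos (c * x))) / A

/-- The second derivative of `oscProfile c A`. -/
noncomputable def oscProfile₂ (c A x : ℝ) : ℝ :=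
  4 * sin (2 * x) / 3 +
    (8 * (cos (2 * x) ^ 2 - sin (2 * x) ^ 2) * sin (c * x) +
      8 * sin (2 * x) * cos (2 * x) * (c * cos (c * x)) -
      sin (2 * x) ^ 2 * (c ^ 2 * sin (c * x))) / A

/-- The third derivative of `oscProfile c A`. -/
noncomputable def oscProfile₃ (c A x : ℝ) : ℝ :=
  8 * cos (2 * x) / 3 +
    (-64 * sin (2 * x) * cos (2 * x) * sin (c * x) +
      24 * (cos (2 * x) ^ 2 - sin (2 * x) ^ 2) * (c * cos (c * x)) -
      12 * sin (2 * x) * cos (2 * x) * (c ^ 2 * sin (c * x)) -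
      sin (2 * x) ^ 2 * (c ^ 3 * cos (c * x))) / A

lemma hasDerivAt_sin_const_mul (c x : ℝ) :
    HasDerivAt (fun y => sin (c * y)) (c * cos (c * x)) x := by
  simpa [mul_comm] using ((hasDerivAt_id x).const_mul c).sin

lemma hasDerivAt_cos_const_mul (c x : ℝ) :
    HasDerivAt (fun y => cos (c * y)) (-(c * sin (c * x))) x := by
  simpa [mul_comm] using ((hasDerivAt_id x).const_mul c).cos

lemma hasDerivAt_oscProfile (c A x : ℝ) :
    HasDerivAt (oscProfile c A) (oscProfile₁ c A x) x := by
  have hs := hasDerivAt_sin_const_mul 2 x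
  have hS := hasDerivAt_sin_const_mul c x
  refine (((hasDerivAt_id x).sub (hs.div_const 3)).add
    (((hs.pow 2).mul hS).div_const A)).congr_deriv ?_
  simp only [oscProfile₁, Pi.pow_apply]
  push_cast
  ring

lemma hasDerivAt_oscProfile₁ (c A x : ℝ) :
    HasDerivAt (oscProfile₁ c A) (oscProfile₂ c A x) x := by
  have hs := hasDerivAt_sin_const_mul 2 x
  have hk := hasDerivAt_cos_const_mul 2 x
  have hS := hasDerivAt_sin_const_mul c x
  have hC := hasDerivAt_cos_const_mul c x
  refine (((hasDerivAt_const x 1).sub ((hk.const_mul 2).div_const 3)).add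
    (((((hs.const_mul 4).mul hk).mul hS).add
      ((hs.pow 2).mul (hC.const_mul c))).div_const A)).congr_deriv ?_
  simp only [oscProfile₂, Pi.pow_apply, Pi.mul_apply]
  push_cast
  ring

lemma hasDerivAt_oscProfile₂ (c A x : ℝ) :
    HasDerivAt (oscProfile₂ c A) (oscProfile₃ c A x) x := by
  have hs := hasDerivAt_sin_const_mul 2 x
  have hk := hasDerivAt_cos_const_mul 2 x
  have hS := hasDerivAt_sin_const_mul c x
  have hC := hasDerivAt_cos_const_mul c x
  refine (((hs.const_mul 4).div_const 3).add
    ((((((hk.pow 2).sub (hs.pow 2)).const_mul 8).mul hS).add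
      (((hs.const_mul 8).mul hk).mul (hC.const_mul c))).sub
      ((hs.pow 2).mul (hS.const_mul (c ^ 2))) |>.div_const A)).congr_deriv ?_
  simp only [oscProfile₃, Pi.pow_apply, Pi.mul_apply, Pi.sub_apply]
  push_cast
  ring

lemma oscProfile_mem_Ioo {c A x : ℝ} (hA : 32 ≤ A) (hx : x ∈ Ioo 0 (π / 2)) :
    oscProfile c A x ∈ Ioo 0 π := by
  obtain ⟨hx0, hx1⟩ := hx
  have hs0 : 0 < sin (2 * x) := sin_pos_of_pos_of_lt_pi (by linarith) (by linarith)
  have hs1 : sin (2 * x) ≤ 1 := sin_le_one _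
  have hs2 : sin (2 * x) < 2 * x := sin_lt (by linarith)
  have hbound : |sin (2 * x) ^ 2 * sin (c * x) / A| ≤ sin (2 * x) / 32 := by
    rw [abs_div, abs_mul, abs_of_pos (by linarith : (0 : ℝ) < A), abs_of_pos (by positivity)]
    have h1 := abs_sin_le_one (c * x)
    gcongr
    calc sin (2 * x) ^ 2 * |sin (c * x)| ≤ sin (2 * x) ^ 2 * 1 := by gcongr
      _ ≤ sin (2 * x) := by nlinarith
  rw [abs_le] at hbound
  constructor <;> unfold oscProfile <;> linarith [pi_pos]

/-- The derivative of `f₁ ^ 2 - cot f * f₂`, where `f₁`, `f₂` are the derivatives of `f`. -/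
lemma hasDerivAt_sq_sub_cot_mul {f f₁ f₂ : ℝ → ℝ} {d₁ d₂ d₃ x : ℝ} (hf : HasDerivAt f d₁ x)
    (hf₁ : HasDerivAt f₁ d₂ x) (hf₂ : HasDerivAt f₂ d₃ x) (h₁ : f₁ x = d₁) (h₂ : f₂ x = d₂)
    (hx : sin (f x) ≠ 0) :
    HasDerivAt (fun y => f₁ y ^ 2 - cos (f y) / sin (f y) * f₂ y)
      (2 * d₁ * d₂ + d₁ * d₂ / sin (f x) ^ 2 - cos (f x) / sin (f x) * d₃) x := by
  refine ((hf₁.pow 2).sub ((hf.cos.div hf.sin hx).mul hf₂)).congr_deriv ?_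
  have := sin_sq_add_cos_sq (f x)
  subst h₁ h₂
  simp only [Pi.div_apply]
  field_simp
  push_cast
  linear_combination (f₁ x * f₂ x) * this

lemma oscillation_estimate {s k e a b n : ℝ} (hn : 2000 ≤ n) (he : e ^ 2 = 1)
    (hsk : s ^ 2 + k ^ 2 = 1) (hs : 1 / 2 ≤ s ^ 2) (ha : 1 / 12 ≤ a) (hb : 1 / 2 ≤ b)
    (hab : a ^ 2 + b ^ 2 = 1) {d₁ d₂ d₃ : ℝ}
    (h₁ : d₁ = 1 - 2 * k / 3 + s ^ 2 * e * (2 / n ^ 3))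
    (h₂ : d₂ = 4 * s / 3 + 8 * s * k * e * (2 / n ^ 3))
    (h₃ : d₃ = 8 * k / 3 + 24 * (k ^ 2 - s ^ 2) * e * (2 / n ^ 3) - 8 * n * s ^ 2 * e) :
    0 < e * (2 * d₁ * d₂ + d₁ * d₂ / a ^ 2 - b / a * d₃) := by
  have hu0 : 0 < 2 / n ^ 3 := by positivity
  have hu1 : 2 / n ^ 3 ≤ 1 := by
    rw [div_le_one (by positivity)]
    calc (2 : ℝ) ≤ 2000 ^ 3 := by norm_num
      _ ≤ n ^ 3 := by gcongr
  generalize 2 / n ^ 3 = u at *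
  have hu : |u| ≤ 1 := by rw [abs_of_pos hu0]; exact hu1
  have he1 : |e| ≤ 1 := by rw [← sq_le_one_iff_abs_le_one]; linarith
  have hs1 : |s| ≤ 1 := by rw [← sq_le_one_iff_abs_le_one]; linarith [sq_nonneg k]
  have hk1 : |k| ≤ 1 := by rw [← sq_le_one_iff_abs_le_one]; linarith [sq_nonneg s]
  have ha1 : |a| ≤ 1 := by rw [← sq_le_one_iff_abs_le_one]; linarith [sq_nonneg b]
  have hb1 : |b| ≤ 1 := by rw [← sq_le_one_iff_abs_le_one]; linarith [sq_nonneg a]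
  have mul_le_one {p q : ℝ} (hp : |p| ≤ 1) (hq : |q| ≤ 1) : |p * q| ≤ 1 := by
    rw [abs_mul]; exact mul_le_one₀ hp (abs_nonneg _) hq
  have heu : |e * u| ≤ 1 := mul_le_one he1 hu
  have hd₁ : |d₁| ≤ 4 := by
    have := mul_le_one (mul_le_one hs1 hs1) heu
    rw [show d₁ = 1 - 2 * k / 3 + s * s * (e * u) by rw [h₁]; ring]
    rw [abs_le] at this hk1 ⊢
    constructor <;> linarith
  have hd₂ : |d₂| ≤ 18 := by
    have := mul_le_one (mul_le_one hs1 hk1) heu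
    rw [show d₂ = 4 * s / 3 + 8 * (s * k * (e * u)) by rw [h₂]; ring]
    rw [abs_le] at this hs1 ⊢
    constructor <;> linarith
  have hd : |d₁ * d₂| ≤ 72 := by
    rw [abs_mul]
    calc |d₁| * |d₂| ≤ 4 * 18 := by gcongr
      _ = 72 := by norm_num
  have ha0 : 0 < a := by linarith
  have hr : |8 * k / 3 + 24 * (k ^ 2 - s ^ 2) * e * u| ≤ 51 := by
    have h1 := mul_le_one (mul_le_one hs1 hs1) heu
    have h2 := mul_le_one (mul_le_one hk1 hk1) heu
    rw [show 8 * k / 3 + 24 * (k ^ 2 - s ^ 2) * e * u =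
      8 * k / 3 + 24 * (k * k * (e * u)) - 24 * (s * s * (e * u)) by ring]
    rw [abs_le] at h1 h2 hk1 ⊢
    constructor <;> linarith
  have hE : |e * (2 * a ^ 2 + 1) * (d₁ * d₂)| ≤ 216 := by
    rw [abs_mul, abs_mul]
    calc |e| * |2 * a ^ 2 + 1| * |d₁ * d₂| ≤ 1 * 3 * 72 := by
          gcongr
          rw [abs_of_pos (by positivity)]
          linarith [sq_nonneg b]
      _ = 216 := by norm_num
  have hF : |e * (a * b) * (8 * k / 3 + 24 * (k ^ 2 - s ^ 2) * e * u)| ≤ 51 := by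
    rw [abs_mul]
    calc |e * (a * b)| * |8 * k / 3 + 24 * (k ^ 2 - s ^ 2) * e * u| ≤ 1 * 51 := by
          gcongr
          exact mul_le_one he1 (mul_le_one ha1 hb1)
      _ = 51 := by norm_num
  have hmain : 333 ≤ 8 * n * s ^ 2 * (a * b) := by
    calc (333 : ℝ) ≤ 8 * 2000 * (1 / 2) * (1 / 12 * (1 / 2)) := by norm_num
      _ ≤ 8 * n * s ^ 2 * (a * b) := by gcongr
  have key : e * (2 * d₁ * d₂ + d₁ * d₂ / a ^ 2 - b / a * d₃) =
      (e * (2 * a ^ 2 + 1) * (d₁ * d₂) -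
        e * (a * b) * (8 * k / 3 + 24 * (k ^ 2 - s ^ 2) * e * u) +
        8 * n * s ^ 2 * (a * b)) / a ^ 2 := by
    rw [h₃]
    field_simp
    linear_combination (24 * n * s ^ 2 * (a * b)) * he
  rw [key]
  rw [abs_le] at hE hF
  apply div_pos _ (by positivity)
  linarith

lemma exists_isLocalMax_of_deriv_pos_of_deriv_neg {f : ℝ → ℝ} {a b : ℝ} (hab : a < b)
    (hf : ContinuousOn f (Icc a b)) (ha : 0 < deriv f a) (hb : deriv f b < 0) :
    ∃ y ∈ Ioo a b, IsLocalMax f y := by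
  obtain ⟨y, hy, hmax⟩ := isCompact_Icc.exists_isMaxOn (nonempty_Icc.2 hab.le) hf
  have hda := (differentiableAt_of_deriv_ne_zero ha.ne').hasDerivAt
  have hdb := (differentiableAt_of_deriv_ne_zero hb.ne).hasDerivAt
  have hya : y ≠ a := by
    rintro rfl
    have hm : b - y ∈ posTangentConeAt (Icc y b) y :=
      sub_mem_posTangentConeAt_of_segment_subset (segment_eq_Icc hab.le ▸ Subset.rfl)
    have := hmax.localize.hasFDerivWithinAt_nonpos hda.hasFDerivAt.hasFDerivWithinAt hm
    simp at this
    nlinarith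
  have hyb : y ≠ b := by
    rintro rfl
    have hm : a - y ∈ posTangentConeAt (Icc a y) y :=
      sub_mem_posTangentConeAt_of_segment_subset
        (by rw [segment_symm, segment_eq_Icc hab.le])
    have := hmax.localize.hasFDerivWithinAt_nonpos hdb.hasFDerivAt.hasFDerivWithinAt hm
    simp at this
    nlinarith
  have hy' : y ∈ Ioo a b := ⟨lt_of_le_of_ne hy.1 hya.symm, lt_of_le_of_ne hy.2 hyb⟩
  exact ⟨y, hy', hmax.isLocalMax (Icc_mem_nhds hy'.1 hy'.2)⟩

lemma exists_isLocalMax_or_isLocalMin_of_deriv_mul_deriv_neg {f : ℝ → ℝ} {a b : ℝ} (hab : a < b)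
    (hf : ContinuousOn f (Icc a b)) (h : deriv f a * deriv f b < 0) :
    ∃ y ∈ Ioo a b, IsLocalMax f y ∨ IsLocalMin f y := by
  rcases mul_neg_iff.1 h with ⟨ha, hb⟩ | ⟨ha, hb⟩
  · obtain ⟨y, hy, hmax⟩ := exists_isLocalMax_of_deriv_pos_of_deriv_neg hab hf ha hb
    exact ⟨y, hy, .inl hmax⟩
  · obtain ⟨y, hy, hmax⟩ := exists_isLocalMax_of_deriv_pos_of_deriv_neg (f := fun x => -f x)
      hab hf.neg (by rw [deriv.fun_neg]; linarith) (by rw [deriv.fun_neg]; linarith)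
    exact ⟨y, hy, .inr (by simpa using hmax.neg)⟩

lemma oscProfile_deriv_curvature_sign {n : ℕ} (hn : 2000 ≤ n) {G : ℝ → ℝ}
    (hG : ∀ x, sin (oscProfile (2 * (n : ℝ) ^ 2) ((n : ℝ) ^ 5) x) ≠ 0 →
      HasDerivAt G
        (2 * oscProfile₁ (2 * (n : ℝ) ^ 2) ((n : ℝ) ^ 5) x *
            oscProfile₂ (2 * (n : ℝ) ^ 2) ((n : ℝ) ^ 5) x +
          oscProfile₁ (2 * (n : ℝ) ^ 2) ((n : ℝ) ^ 5) x *
            oscProfile₂ (2 * (n : ℝ) ^ 2) ((n : ℝ) ^ 5) x /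
            sin (oscProfile (2 * (n : ℝ) ^ 2) ((n : ℝ) ^ 5) x) ^ 2 -
          cos (oscProfile (2 * (n : ℝ) ^ 2) ((n : ℝ) ^ 5) x) /
            sin (oscProfile (2 * (n : ℝ) ^ 2) ((n : ℝ) ^ 5) x) *
            oscProfile₃ (2 * (n : ℝ) ^ 2) ((n : ℝ) ^ 5) x) x)
    {j : ℕ} {x : ℝ} (hj : x = j * π / (2 * (n : ℝ) ^ 2)) (hx : x ∈ Icc (π / 8) (π / 4)) :
    0 < (-1) ^ j * deriv G x := by
  obtain ⟨hx0, hx1⟩ := hx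
  have hpi := pi_pos
  have hnR : (2000 : ℝ) ≤ n := by exact_mod_cast hn
  have hn0 : (n : ℝ) ≠ 0 := by positivity
  have hcx : 2 * (n : ℝ) ^ 2 * x = j * π := by rw [hj]; field_simp
  have hS : sin (2 * (n : ℝ) ^ 2 * x) = 0 := by rw [hcx]; exact sin_nat_mul_pi j
  have hC : cos (2 * (n : ℝ) ^ 2 * x) = (-1) ^ j := by rw [hcx]; exact cos_nat_mul_pi j
  have hf : oscProfile (2 * (n : ℝ) ^ 2) ((n : ℝ) ^ 5) x = x - sin (2 * x) / 3 := by
    simp [oscProfile, hS]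
  have hs1 : sin (2 * x) ≤ 2 * x := sin_le (by linarith)
  have hs0 : 0 ≤ sin (2 * x) := sin_nonneg_of_nonneg_of_le_pi (by linarith) (by linarith)
  have hs2 : 1 / 2 ≤ sin (2 * x) ^ 2 := by
    have : sin (π / 4) ≤ sin (2 * x) :=
      sin_le_sin_of_le_of_le_pi_div_two (by linarith) (by linarith) (by linarith)
    rw [sin_pi_div_four] at this
    calc (1 / 2 : ℝ) = (√2 / 2) ^ 2 := by rw [div_pow, sq_sqrt (by norm_num)]; norm_num
      _ ≤ _ := by gcongr
  have hsin : 1 / 12 ≤ sin (x - sin (2 * x) / 3) := by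
    have := mul_le_sin (x := x - sin (2 * x) / 3) (by linarith) (by linarith)
    calc (1 / 12 : ℝ) = 2 / π * (π / 24) := by field_simp; norm_num
      _ ≤ 2 / π * (x - sin (2 * x) / 3) := by gcongr; linarith
      _ ≤ _ := this
  have hcos : 1 / 2 ≤ cos (x - sin (2 * x) / 3) := by
    rw [← cos_pi_div_three]
    exact cos_le_cos_of_nonneg_of_le_pi (by linarith) (by linarith) (by linarith)
  rw [(hG x (by rw [hf]; linarith)).deriv, hf]
  refine oscillation_estimate hnR (s := sin (2 * x)) (k := cos (2 * x)) ?_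
    (sin_sq_add_cos_sq _) hs2 hsin hcos (sin_sq_add_cos_sq _) ?_ ?_ ?_
  · rw [← pow_mul, mul_comm, pow_mul]; simp
  · simp only [oscProfile₁, hS, hC]; field_simp; ring
  · simp only [oscProfile₂, hS, hC]; field_simp; ring
  · simp only [oscProfile₃, hS, hC]; field_simp; ring

/-- For each integer `n ≥ 2` let `h_n(x) := x − sin(2x)/3 + sin²(2x)·sin(2n²x)/n⁵`,
so that `m_n(r) = 3·sin(h_n(r))` defines the 2-sphere of revolution `M_n`, whose Gaussian
curvature as a function of the radial coordinate is
`G̃_n(x) := h_n'(x)² − (cos(h_n(x))/sin(h_n(x)))·h_n''(x)`.  Then for every `N` there is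
`n₀` such that for all integers `n > n₀`: `h_n` maps `(0,π/2)` into `(0,π)`, and there are
points `0 < x₁ < ⋯ < x_N < π/2` with `G̃_n'(x_i)·G̃_n'(x_{i+1}) < 0` for `i = 1,…,N−1`;
consequently the number of points on each meridian attaining a local maximum or minimum of
the Gaussian curvature tends to infinity as `n → ∞`. -/
theorem curvature_oscillation_of_Mn
    (h : ℕ → ℝ → ℝ)
    (hh : ∀ n x, h n x =
      x - Real.sin (2 * x) / 3 +
        Real.sin (2 * x) ^ 2 * Real.sin (2 * (n : ℝ) ^ 2 * x) / (n : ℝ) ^ 5)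
    (G : ℕ → ℝ → ℝ)
    (hG : ∀ n x, G n x =
      (deriv (h n) x) ^ 2 -
        (Real.cos (h n x) / Real.sin (h n x)) * deriv (deriv (h n)) x) :
    ∀ N : ℕ, ∃ n₀ : ℕ, 2 ≤ n₀ ∧ ∀ n : ℕ, n₀ < n →
      (∀ x ∈ Set.Ioo 0 (π / 2), h n x ∈ Set.Ioo 0 π) ∧
      (∃ x : Fin N → ℝ, StrictMono x ∧ (∀ i, x i ∈ Set.Ioo 0 (π / 2)) ∧
        ∀ i : ℕ, ∀ hi : i + 1 < N,
          deriv (G n) (x ⟨i, Nat.lt_of_succ_lt hi⟩) * deriv (G n) (x ⟨i + 1, hi⟩) < 0) ∧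
      (∃ S : Finset ℝ, N ≤ S.card ∧ ∀ x ∈ S, x ∈ Set.Ioo 0 (π / 2) ∧
        (IsLocalMax (G n) x ∨ IsLocalMin (G n) x)) := by
  intro N
  refine ⟨max N 2000, le_max_of_le_right (by norm_num), fun n hn => ?_⟩
  have hnN : N ≤ n := ((le_max_left _ _).trans_lt hn).le
  have hn2 : 2000 ≤ n := ((le_max_right _ _).trans_lt hn).le
  have hnR : (2000 : ℝ) ≤ n := by exact_mod_cast hn2
  have hpi := pi_pos
  have hh' : h n = oscProfile (2 * (n : ℝ) ^ 2) ((n : ℝ) ^ 5) := funext (hh n)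
  have hd₁ : deriv (h n) = oscProfile₁ (2 * (n : ℝ) ^ 2) ((n : ℝ) ^ 5) := by
    rw [hh']; exact funext fun x => (hasDerivAt_oscProfile _ _ x).deriv
  have hd₂ : deriv (deriv (h n)) = oscProfile₂ (2 * (n : ℝ) ^ 2) ((n : ℝ) ^ 5) := by
    rw [hd₁]; exact funext fun x => (hasDerivAt_oscProfile₁ _ _ x).deriv
  have hrange : ∀ x ∈ Ioo 0 (π / 2), h n x ∈ Ioo 0 π := by
    intro x hx
    rw [hh']
    refine oscProfile_mem_Ioo ?_ hx
    calc (32 : ℝ) ≤ 2000 ^ 5 := by norm_num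
      _ ≤ (n : ℝ) ^ 5 := by gcongr
  have hGn : G n = _ := funext (hG n)
  rw [hd₂, hd₁, hh'] at hGn
  have hGd := fun x hx => hasDerivAt_sq_sub_cot_mul
    (hasDerivAt_oscProfile (2 * (n : ℝ) ^ 2) ((n : ℝ) ^ 5) x) (hasDerivAt_oscProfile₁ _ _ x)
    (hasDerivAt_oscProfile₂ _ _ x) rfl rfl hx
  rw [← hGn] at hGd
  have hcont : ContinuousOn (G n) (Ioo 0 (π / 2)) := fun x hx =>
    (hGd x (hh' ▸ (sin_pos_of_mem_Ioo (hrange x hx)).ne')).continuousAt.continuousWithinAt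
  set p : ℕ → ℝ := fun i => ((n ^ 2 / 4 + 1 + i : ℕ) : ℝ) * π / (2 * (n : ℝ) ^ 2) with hp
  have hpmono : StrictMono p := by
    intro i j hij
    simp only [hp]
    gcongr
  have hpmem : ∀ i ≤ N, p i ∈ Icc (π / 8) (π / 4) := by
    intro i hi
    have h1 : n ^ 2 ≤ 4 * (n ^ 2 / 4 + 1 + i) := by lia
    have h2 : 2 * (n ^ 2 / 4 + 1 + i) ≤ n ^ 2 := by
      have : 2000 * n ≤ n ^ 2 := by nlinarith
      lia
    have h1' : (n : ℝ) ^ 2 ≤ 4 * ((n ^ 2 / 4 + 1 + i : ℕ) : ℝ) := by exact_mod_cast h1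
    have h2' : 2 * ((n ^ 2 / 4 + 1 + i : ℕ) : ℝ) ≤ (n : ℝ) ^ 2 := by exact_mod_cast h2
    simp only [hp]
    constructor
    · rw [le_div_iff₀ (by positivity)]; nlinarith
    · rw [div_le_iff₀ (by positivity)]; nlinarith
  have hIcc : Icc (π / 8) (π / 4) ⊆ Ioo 0 (π / 2) := fun x hx =>
    ⟨by linarith [hx.1], by linarith [hx.2]⟩
  have hsign : ∀ i ≤ N, 0 < (-1) ^ (n ^ 2 / 4 + 1 + i) * deriv (G n) (p i) := fun i hi =>
    oscProfile_deriv_curvature_sign hn2 hGd rfl (hpmem i hi)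
  have halt : ∀ i < N, deriv (G n) (p i) * deriv (G n) (p (i + 1)) < 0 := by
    intro i hi
    have h1 := mul_pos (hsign i hi.le) (hsign (i + 1) hi)
    have h2 : ((-1 : ℝ) ^ (n ^ 2 / 4 + 1 + i)) ^ 2 = 1 := by
      rw [← pow_mul, mul_comm, pow_mul]; simp
    rw [← add_assoc, pow_succ (-1 : ℝ) (n ^ 2 / 4 + 1 + i)] at h1
    generalize (-1 : ℝ) ^ (n ^ 2 / 4 + 1 + i) = e at h1 h2
    linear_combination h1 - (deriv (G n) (p i) * deriv (G n) (p (i + 1))) * h2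
  refine ⟨hrange, ⟨fun i => p i, fun i j hij => hpmono hij, fun i => hIcc (hpmem i i.2.le),
    fun i hi => halt i (by lia)⟩, ?_⟩
  have hex : ∀ i : Fin N, ∃ y ∈ Ioo (p i) (p (i + 1)), IsLocalMax (G n) y ∨ IsLocalMin (G n) y :=
    fun i => exists_isLocalMax_or_isLocalMin_of_deriv_mul_deriv_neg (hpmono (Nat.lt_succ_self i))
      (hcont.mono ((Icc_subset_Icc (hpmem i i.2.le).1 (hpmem (i + 1) i.2).2).trans hIcc))
      (halt i i.2)
  choose y hy hext using hex
  have hymono : StrictMono y := fun i j hij =>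
    (hy i).2.trans_le ((hpmono.monotone (Nat.succ_le_of_lt hij)).trans (hy j).1.le)
  refine ⟨Finset.univ.image y, ?_, ?_⟩
  · rw [Finset.card_image_of_injective _ hymono.injective]; simp
  · intro x hx
    obtain ⟨i, -, rfl⟩ := Finset.mem_image.1 hx
    exact ⟨hIcc ⟨(hpmem i i.2.le).1.trans (hy i).1.le, (hy i).2.le.trans (hpmem (i + 1) i.2).2⟩,
      hext i⟩
end
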